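/- arXiv:2409.18187 — 10 statements merged into one kernel-verified Lean document; each statement's English description precedes it below -/
import Mathlib

section
/- Let (G,φ) be a group with parity. The sequence of wreath products {G≀Σ_{n+1}}_{n≥0}, equipped with the operations ψ* and (g_0,…,g_n;γ)* of the twisted symmetric construction, satisfies all six crossed-simplicial-group identities (1.h), (2.h), (3.h), (1.v), (2.v), (3.v); hence the construction defines a crossed simplicial group Δφ≀Σ (recovering Δ𝐒 when G is trivial and the hyperoctahedral crossed simplicial group ΔH when φ = id: C₂ → C₂). -/
/-!
STATEMENT 0: For a group with parity `(G, φ)`, the wreath products `G ≀ Σ_{n+1}`, equipped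
with the operations of the twisted symmetric construction, satisfy all six
crossed-simplicial-group identities; hence the construction defines a crossed simplicial
group `Δφ≀Σ`.
-/

open CategoryTheory SimplexCategory

/-- The underlying set of the wreath product `G ≀ Σ_{n+1}`. -/
abbrev W (G : Type) (n : ℕ) : Type := (Fin (n + 1) → G) × Equiv.Perm (Fin (n + 1))

/-- The wreath product multiplication
`(g_0,…,g_n;γ)·(g'_0,…,g'_n;γ') = (g_0 g'_{γ⁻¹(0)},…,g_n g'_{γ⁻¹(n)}; γγ')`. -/
def wmul {G : Type} [Group G] {n : ℕ} (x y : W G n) : W G n :=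
  (fun i => x.1 i * y.1 (x.2⁻¹ i), x.2 * y.2)

/-- The identity element of the wreath product. -/
def wone {G : Type} [Group G] {n : ℕ} : W G n := (fun _ => 1, 1)

/-- The crossed simplicial structure of the symmetric crossed simplicial group `Δ𝐒`:
for `γ ∈ Σ_{n+1}` and `ψ ∈ Δ([m],[n])`, the pair `(γ*(ψ), ψ*(γ))` is (uniquely) determined
by the requirements `γ ∘ (γ*(ψ)) = ψ ∘ (ψ*(γ))` as maps of sets and that `ψ*(γ)` maps each
fiber of `γ*(ψ)` order-preservingly onto the corresponding fiber of `ψ`. -/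
structure SymCSG : Type where
  vact : ∀ {m n : ℕ}, Equiv.Perm (Fin (n + 1)) → (mk m ⟶ mk n) → (mk m ⟶ mk n)
  hact : ∀ {m n : ℕ}, (mk m ⟶ mk n) → Equiv.Perm (Fin (n + 1)) → Equiv.Perm (Fin (m + 1))
  compat : ∀ {m n : ℕ} (γ : Equiv.Perm (Fin (n + 1))) (ψ : mk m ⟶ mk n) (x : Fin (m + 1)),
    γ ((vact γ ψ).toOrderHom x) = ψ.toOrderHom (hact ψ γ x)
  fiber_mono : ∀ {m n : ℕ} (γ : Equiv.Perm (Fin (n + 1))) (ψ : mk m ⟶ mk n)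
    (x y : Fin (m + 1)), (vact γ ψ).toOrderHom x = (vact γ ψ).toOrderHom y → x ≤ y →
      hact ψ γ x ≤ hact ψ γ y

section TwistedSymmetric

variable {G : Type} [Group G] (φ : G →* ℤˣ) (S : SymCSG) {k m n : ℕ}

/-- The key by which the permutation part of `ψ*(g;γ)` sorts `{0,…,m}`: first by `γ⁻¹ ∘ ψ`, and
within a fiber of `ψ` increasingly or decreasingly according to the parity of `g` there. -/
def twistedKey (ψ : mk m ⟶ mk n) (x : W G n) (i : Fin (m + 1)) : Fin (n + 1) ×ₗ ℤ :=
  toLex (x.2⁻¹ (ψ.toOrderHom i), (φ (x.1 (ψ.toOrderHom i)) : ℤ) * (i : ℕ))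

variable {φ} in
theorem twistedKey_lt_iff {ψ : mk m ⟶ mk n} {x : W G n} {i j : Fin (m + 1)} :
    twistedKey φ ψ x i < twistedKey φ ψ x j ↔
      x.2⁻¹ (ψ.toOrderHom i) < x.2⁻¹ (ψ.toOrderHom j) ∨
      ψ.toOrderHom i = ψ.toOrderHom j ∧
        (φ (x.1 (ψ.toOrderHom j)) = 1 ∧ i < j ∨ φ (x.1 (ψ.toOrderHom j)) = -1 ∧ j < i) := by
  rw [twistedKey, twistedKey, Prod.Lex.toLex_lt_toLex]
  refine or_congr Iff.rfl ?_
  simp only [EmbeddingLike.apply_eq_iff_eq]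
  refine and_congr_right fun h => ?_
  rw [h]
  rcases Int.units_eq_one_or (φ (x.1 (ψ.toOrderHom j))) with h1 | h1 <;>
    simp [h1, show (1 : ℤˣ) ≠ -1 by decide, show (-1 : ℤˣ) ≠ 1 by decide]

theorem twistedKey_injective (ψ : mk m ⟶ mk n) (x : W G n) :
    Function.Injective (twistedKey φ ψ x) := by
  intro i j h
  have h' := toLex.injective h
  simp only [Prod.mk.injEq, EmbeddingLike.apply_eq_iff_eq] at h'
  obtain ⟨h1, h2⟩ := h'
  rw [h1] at h2
  have := mul_left_cancel₀ (Units.ne_zero _) h2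
  exact Fin.ext (by exact_mod_cast this)

/-- `p` is the permutation sorting `{0,…,m}` by `twistedKey φ ψ x`. -/
def IsTwistedSort (ψ : mk m ⟶ mk n) (x : W G n) (p : Equiv.Perm (Fin (m + 1))) : Prop :=
  StrictMono (twistedKey φ ψ x ∘ p)

variable {φ}

theorem isTwistedSort_sort (ψ : mk m ⟶ mk n) (x : W G n) :
    IsTwistedSort φ ψ x (Tuple.sort (twistedKey φ ψ x)) :=
  (Tuple.monotone_sort _).strictMono_of_injective
    ((twistedKey_injective φ ψ x).comp (Equiv.injective _))

theorem IsTwistedSort.unique {ψ : mk m ⟶ mk n} {x : W G n} {p q : Equiv.Perm (Fin (m + 1))}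
    (hp : IsTwistedSort φ ψ x p) (hq : IsTwistedSort φ ψ x q) : p = q := by
  have h : twistedKey φ ψ x ∘ p = twistedKey φ ψ x ∘ q := by
    refine (StrictMono.range_inj hp hq).1 ?_
    rw [p.surjective.range_comp, q.surjective.range_comp]
  exact Equiv.ext fun i => twistedKey_injective φ ψ x (congrFun h i)

theorem IsTwistedSort.monotone {ψ : mk m ⟶ mk n} {x : W G n} {p : Equiv.Perm (Fin (m + 1))}
    (hp : IsTwistedSort φ ψ x p) : Monotone fun a => x.2⁻¹ (ψ.toOrderHom (p a)) := by
  intro a b hab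
  rcases hab.eq_or_lt with rfl | hab
  · exact le_rfl
  · rcases twistedKey_lt_iff.1 (hp hab) with h | ⟨h, -⟩
    · exact h.le
    · exact (congrArg _ h).le

theorem eq_of_monotone_of_comp_perm {n : ℕ} {α : Type*} [LinearOrder α] {f f' : Fin n → α}
    (hf : Monotone f) (hf' : Monotone f') (p : Equiv.Perm (Fin n)) (h : ∀ a, f a = f' (p a)) :
    f = f' := by
  obtain rfl : f = f' ∘ p := funext h
  exact Tuple.unique_monotone (τ := 1) hf hf'

theorem IsTwistedSort.fiber {ψ : mk m ⟶ mk n} {g : Fin (n + 1) → G}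
    {p : Equiv.Perm (Fin (m + 1))} (hp : IsTwistedSort φ ψ (g, 1) p) (a : Fin (m + 1)) :
    ψ.toOrderHom (p a) = ψ.toOrderHom a := by
  have h : Monotone fun a => ψ.toOrderHom (p a) := by simpa using hp.monotone
  exact congrFun (eq_of_monotone_of_comp_perm h ψ.toOrderHom.monotone p fun _ => rfl) a

namespace SymCSG

theorem vact_unique (γ : Equiv.Perm (Fin (n + 1))) (ψ f : SimplexCategory.mk m ⟶ SimplexCategory.mk n)
    (p : Equiv.Perm (Fin (m + 1))) (h : ∀ a, γ (f.toOrderHom a) = ψ.toOrderHom (p a)) :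
    S.vact γ ψ = f := by
  apply SimplexCategory.Hom.ext
  apply OrderHom.ext
  refine eq_of_monotone_of_comp_perm (S.vact γ ψ).toOrderHom.monotone f.toOrderHom.monotone
    (p⁻¹ * S.hact ψ γ) fun a => γ.injective ?_
  rw [S.compat, h]
  simp

theorem vact_apply_of_isTwistedSort {ψ : SimplexCategory.mk m ⟶ SimplexCategory.mk n} {x : W G n}
    {p : Equiv.Perm (Fin (m + 1))} (hp : IsTwistedSort φ ψ x p) (a : Fin (m + 1)) :
    (S.vact x.2 ψ).toOrderHom a = x.2⁻¹ (ψ.toOrderHom (p a)) := by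
  rw [S.vact_unique x.2 ψ (SimplexCategory.Hom.mk ⟨_, hp.monotone⟩) p fun _ => by simp]
  rfl

theorem isTwistedSort_hact (γ : Equiv.Perm (Fin (n + 1))) (ψ : SimplexCategory.mk m ⟶ SimplexCategory.mk n) :
    IsTwistedSort φ ψ (fun _ => 1, γ) (S.hact ψ γ) := by
  intro a b hab
  refine twistedKey_lt_iff.2 ?_
  simp only [map_one, ← S.compat, Equiv.Perm.inv_def, Equiv.symm_apply_apply,
    EmbeddingLike.apply_eq_iff_eq]
  rcases ((S.vact γ ψ).toOrderHom.monotone hab.le).lt_or_eq with h | h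
  · exact .inl h
  · exact .inr ⟨h, .inl ⟨trivial, (S.fiber_mono γ ψ a b h hab.le).lt_of_ne (by simpa using hab.ne)⟩⟩

end SymCSG

theorem isTwistedSort_id (x : W G n) : IsTwistedSort φ (𝟙 (mk n)) x x.2 := by
  intro a b hab
  exact twistedKey_lt_iff.2 (.inl (by simpa using hab))

theorem isTwistedSort_one (ψ : mk m ⟶ mk n) : IsTwistedSort φ ψ wone 1 := by
  intro a b hab
  refine twistedKey_lt_iff.2 ?_
  rcases (ψ.toOrderHom.monotone hab.le).lt_or_eq with h | h
  · exact .inl h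
  · exact .inr ⟨h, .inl ⟨map_one φ, hab⟩⟩

theorem isTwistedSort_δ (i : Fin (n + 2)) (g : Fin (n + 2) → G) :
    IsTwistedSort φ (SimplexCategory.δ i) (g, 1) 1 := by
  intro a b hab
  exact twistedKey_lt_iff.2 (.inl (Fin.strictMono_succAbove i hab))

theorem isTwistedSort_σ (i : Fin (n + 1)) (g : Fin (n + 1) → G) :
    IsTwistedSort φ (SimplexCategory.σ i) (g, 1)
      (if φ (g i) = 1 then 1 else Equiv.swap i.castSucc i.succ) := by
  intro a b hab
  refine twistedKey_lt_iff.2 ?_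
  have hσ : ∀ c, (SimplexCategory.σ i).toOrderHom c = i.predAbove c := fun _ => rfl
  have hs : ∀ c, i.predAbove (Equiv.swap i.castSucc i.succ c) = i.predAbove c := by
    intro c
    rcases eq_or_ne c i.castSucc with rfl | h1
    · simp
    · rcases eq_or_ne c i.succ with rfl | h2
      · simp
      · rw [Equiv.swap_apply_of_ne_of_ne h1 h2]
  have hp : ∀ c, i.predAbove ((if φ (g i) = 1 then (1 : Equiv.Perm (Fin (n + 2)))
      else Equiv.swap i.castSucc i.succ) c) = i.predAbove c := by
    intro c
    split_ifs
    · rfl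
    · exact hs c
  simp only [hσ, hp, inv_one, Equiv.Perm.one_apply]
  rcases (Fin.predAbove_right_monotone i hab.le).lt_or_eq with h | h
  · exact .inl h
  · obtain ⟨rfl, rfl⟩ : a = i.castSucc ∧ b = i.succ := by
      have h' := congrArg Fin.val h
      simp only [Fin.predAbove, Fin.lt_def, Fin.ext_iff, Fin.val_castSucc, Fin.val_succ]
        at h' hab ⊢
      split_ifs at h' <;> simp only [Fin.val_pred, Fin.coe_castPred] at h' <;>
        omega
    refine .inr ⟨h, ?_⟩
    rw [Fin.predAbove_succ_self]
    rcases Int.units_eq_one_or (φ (g i)) with h1 | h1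
    · simp [h1]
    · simp [h1, show (-1 : ℤˣ) ≠ 1 by decide]

/-- The permutation part of `ψ*(g;γ) = ψ*(g;id) · ψ*(e;γ)`. -/
theorem IsTwistedSort.mul_of_one {ψ : mk m ⟶ mk n} {x : W G n}
    {p q : Equiv.Perm (Fin (m + 1))} (hp : IsTwistedSort φ ψ (x.1, 1) p)
    (hq : IsTwistedSort φ ψ (fun _ => 1, x.2) q) : IsTwistedSort φ ψ x (p * q) := by
  intro a b hab
  refine twistedKey_lt_iff.2 ?_
  simp only [Equiv.Perm.mul_apply, hp.fiber]
  rcases twistedKey_lt_iff.1 (hq hab) with h | ⟨h, h' | h'⟩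
  · exact .inl h
  · right
    rcases twistedKey_lt_iff.1 (hp h'.2) with h2 | ⟨-, h2⟩
    · simp [hp.fiber, h] at h2
    · exact ⟨h, by simpa only [hp.fiber] using h2⟩
  · simp [show (1 : ℤˣ) ≠ -1 by decide] at h'

/-- The permutation part of `(ψ∘χ)*(g) = χ*(ψ*(g))`. -/
theorem IsTwistedSort.comp {ψ : mk m ⟶ mk n} {χ : mk k ⟶ mk m} {x : W G n}
    {p : Equiv.Perm (Fin (m + 1))} {q : Equiv.Perm (Fin (k + 1))} (hp : IsTwistedSort φ ψ x p)
    (hq : IsTwistedSort φ χ (fun j => x.1 (ψ.toOrderHom j), p) q) :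
    IsTwistedSort φ (χ ≫ ψ) x q := by
  intro a b hab
  refine twistedKey_lt_iff.2 ?_
  have hc : ∀ c, (χ ≫ ψ).toOrderHom c = ψ.toOrderHom (χ.toOrderHom c) := fun _ => rfl
  simp only [hc]
  rcases twistedKey_lt_iff.1 (hq hab) with h | ⟨h, h'⟩
  · have h2 := twistedKey_lt_iff.1 (hp h)
    simp only [Equiv.Perm.inv_def, Equiv.apply_symm_apply] at h2
    rcases h2 with h2 | ⟨h2, h3⟩
    · exact .inl h2
    · exact .inr ⟨h2, h3.imp (And.imp_right fun h => χ.toOrderHom.monotone.reflect_lt h)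
        (And.imp_right fun h => χ.toOrderHom.monotone.reflect_lt h)⟩
  · exact .inr ⟨congrArg _ h, h'⟩

/-- The permutation part of `ψ*(gh) = ψ*(g) · (g*(ψ))*(h)`. -/
theorem IsTwistedSort.mul_vact {ψ : mk m ⟶ mk n} {x y : W G n} {p q : Equiv.Perm (Fin (m + 1))}
    (hp : IsTwistedSort φ ψ x p) (hq : IsTwistedSort φ (S.vact x.2 ψ) y q) :
    IsTwistedSort φ ψ (wmul x y) (p * q) := by
  intro a b hab
  refine twistedKey_lt_iff.2 ?_
  simp only [wmul, mul_inv_rev, Equiv.Perm.mul_apply, map_mul]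
  have h := twistedKey_lt_iff.1 (hq hab)
  simp only [S.vact_apply_of_isTwistedSort hp, EmbeddingLike.apply_eq_iff_eq] at h
  refine h.imp id fun ⟨h1, h2⟩ => ⟨h1, ?_⟩
  rcases h2 with ⟨hs, h2⟩ | ⟨hs, h2⟩ <;>
    have h3 := twistedKey_lt_iff.1 (hp h2) <;>
    rw [h1] at h3 <;>
    simp only [lt_self_iff_false, true_and, false_or] at h3 <;>
    rw [hs]
  · simpa using h3
  · rcases h3 with ⟨h4, h5⟩ | ⟨h4, h5⟩
    · right; simp [h4, h5]
    · left; simp [h4, h5]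

end TwistedSymmetric

/-- The twisted symmetric construction `Δφ≀Σ` associated to a group with parity
`φ : G → C₂` defines a crossed simplicial group: there are operations `ψ*` and
`(g_0,…,g_n;γ)*` on the wreath products `G ≀ Σ_{n+1}` given by the formulas of the
construction and satisfying the six crossed-simplicial-group identities
(1.h), (2.h), (3.h), (1.v), (2.v), (3.v). -/
theorem stmt0 (G : Type) [Group G] (φ : G →* ℤˣ) (S : SymCSG) :
    ∃ (hact : ∀ (m n : ℕ), (mk m ⟶ mk n) → W G n → W G m)
      (vact : ∀ (m n : ℕ), W G n → (mk m ⟶ mk n) → (mk m ⟶ mk n)),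
      -- `(g_0,…,g_n;γ)*(ψ) = γ*(ψ)`, computed in `Δ𝐒`
      (∀ (m n : ℕ) (x : W G n) (ψ : mk m ⟶ mk n), vact m n x ψ = S.vact x.2 ψ) ∧
      -- `ψ*(e,…,e;γ) = (e,…,e; ψ*(γ))`, computed in `Δ𝐒`
      (∀ (m n : ℕ) (γ : Equiv.Perm (Fin (n + 1))) (ψ : mk m ⟶ mk n),
        hact m n ψ ((fun _ => 1), γ) = ((fun _ => 1), S.hact ψ γ)) ∧
      -- `δ_i*(g_0,…,g_n; id) = (g_0,…,g_{i-1},g_{i+1},…,g_n; id)`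
      (∀ (n : ℕ) (i : Fin (n + 2)) (g : Fin (n + 2) → G),
        hact n (n + 1) (SimplexCategory.δ i) (g, 1)
          = ((fun j => g ((SimplexCategory.δ i).toOrderHom j)), 1)) ∧
      -- `σ_i*(g_0,…,g_n; id) = (g_0,…,g_i,g_i,…,g_n; τ)` with `τ` determined by `φ(g_i)`
      (∀ (n : ℕ) (i : Fin (n + 1)) (g : Fin (n + 1) → G),
        hact (n + 1) n (SimplexCategory.σ i) (g, 1)
          = ((fun j => g ((SimplexCategory.σ i).toOrderHom j)),
             if φ (g i) = 1 then 1 else Equiv.swap i.castSucc i.succ)) ∧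
      -- `ψ*(g;γ) = ψ*(g;id) · ψ*(e;γ)`
      (∀ (m n : ℕ) (ψ : mk m ⟶ mk n) (x : W G n),
        hact m n ψ x = wmul (hact m n ψ (x.1, 1)) (hact m n ψ ((fun _ => 1), x.2))) ∧
      -- identity (1.h):  `(ψ∘χ)*(g) = χ*(ψ*(g))`
      (∀ (k m n : ℕ) (ψ : mk m ⟶ mk n) (χ : mk k ⟶ mk m) (x : W G n),
        hact k n (χ ≫ ψ) x = hact k m χ (hact m n ψ x)) ∧
      -- identity (3.h):  `(id)*(g) = g` and `ψ*(e) = e`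
      (∀ (n : ℕ) (x : W G n), hact n n (𝟙 (mk n)) x = x) ∧
      (∀ (m n : ℕ) (ψ : mk m ⟶ mk n), hact m n ψ wone = wone) ∧
      -- identity (1.v):  `(gh)*(ψ) = h*(g*(ψ))`
      (∀ (m n : ℕ) (x y : W G n) (ψ : mk m ⟶ mk n),
        vact m n (wmul x y) ψ = vact m n y (vact m n x ψ)) ∧
      -- identity (3.v):  `e*(ψ) = ψ` and `g*(id) = id`
      (∀ (m n : ℕ) (ψ : mk m ⟶ mk n), vact m n wone ψ = ψ) ∧
      (∀ (n : ℕ) (x : W G n), vact n n x (𝟙 (mk n)) = 𝟙 (mk n)) ∧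
      -- identity (2.h):  `g*(ψ∘χ) = g*(ψ) ∘ (ψ*(g))*(χ)`
      (∀ (k m n : ℕ) (ψ : mk m ⟶ mk n) (χ : mk k ⟶ mk m) (x : W G n),
        vact k n x (χ ≫ ψ) = vact k m (hact m n ψ x) χ ≫ vact m n x ψ) ∧
      -- identity (2.v):  `ψ*(gh) = ψ*(g) · (g*(ψ))*(h)`
      (∀ (m n : ℕ) (ψ : mk m ⟶ mk n) (x y : W G n),
        hact m n ψ (wmul x y) = wmul (hact m n ψ x) (hact m n (vact m n x ψ) y)) := by
  let H : ∀ m n : ℕ, (mk m ⟶ mk n) → W G n → W G m := fun m n ψ x =>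
    (fun j => x.1 (ψ.toOrderHom j), Tuple.sort (twistedKey φ ψ x))
  have hH : ∀ {m n : ℕ} (ψ : mk m ⟶ mk n) (x : W G n), IsTwistedSort φ ψ x (H m n ψ x).2 :=
    fun ψ x => isTwistedSort_sort ψ x
  have hH' : ∀ {m n : ℕ} (ψ : mk m ⟶ mk n) (x : W G n) (y : W G m),
      (∀ j, x.1 (ψ.toOrderHom j) = y.1 j) → IsTwistedSort φ ψ x y.2 → H m n ψ x = y :=
    fun ψ x y h1 h2 => Prod.ext (funext h1) ((hH ψ x).unique h2)
  refine ⟨H, fun m n x ψ => S.vact x.2 ψ, fun _ _ _ _ => rfl, ?_, ?_, ?_, ?_, ?_, ?_, ?_, ?_, ?_,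
    ?_, ?_, ?_⟩
  · exact fun m n γ ψ => hH' _ _ _ (fun _ => rfl) (S.isTwistedSort_hact γ ψ)
  · exact fun n i g => hH' _ _ _ (fun _ => rfl) (isTwistedSort_δ i g)
  · exact fun n i g => hH' _ _ _ (fun _ => rfl) (isTwistedSort_σ i g)
  · exact fun m n ψ x => hH' _ _ _ (fun _ => (mul_one _).symm) ((hH _ _).mul_of_one (hH _ _))
  · exact fun k m n ψ χ x => hH' _ _ _ (fun _ => rfl) ((hH ψ x).comp (hH χ (H m n ψ x)))
  · exact fun n x => hH' _ _ _ (fun _ => rfl) (isTwistedSort_id x)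
  · exact fun m n ψ => hH' _ _ _ (fun _ => rfl) (isTwistedSort_one ψ)
  · intro m n x y ψ
    refine S.vact_unique _ _ _ (S.hact ψ x.2 * S.hact (S.vact x.2 ψ) y.2) fun a => ?_
    simp only [wmul, Equiv.Perm.mul_apply, S.compat]
  · exact fun m n ψ => S.vact_unique _ _ _ 1 fun _ => rfl
  · exact fun n x => S.vact_unique _ _ _ x.2 fun _ => rfl
  · intro k m n ψ χ x
    refine S.vact_unique _ _ _ (S.hact χ (H m n ψ x).2) fun a => ?_
    change x.2 ((S.vact x.2 ψ).toOrderHom ((S.vact (H m n ψ x).2 χ).toOrderHom a)) =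
      ψ.toOrderHom (χ.toOrderHom _)
    rw [S.vact_apply_of_isTwistedSort (hH ψ x), S.compat, Equiv.Perm.inv_def, Equiv.apply_symm_apply]
  · intro m n ψ x y
    refine hH' _ _ _ (fun j => ?_) ((hH ψ x).mul_vact S (hH _ y))
    change _ = x.1 (ψ.toOrderHom j) * y.1 ((S.vact x.2 ψ).toOrderHom _)
    rw [S.vact_apply_of_isTwistedSort (hH ψ x), Equiv.Perm.inv_def (H m n ψ x).2,
      Equiv.apply_symm_apply]
    rfl
end

section
/- Let (G,φ) be a group with parity, n ≥ 1 and 0 ≤ i ≤ n. For all elements (g_0,…,g_n;γ) and (g'_0,…,g'_n;γ') of G≀Σ_{n+1}, the operation δ_i* of the twisted symmetric construction satisfies δ_i*((g_0,…,g_n;γ)·(g'_0,…,g'_n;γ')) = δ_i*(g_0,…,g_n;γ) · δ_{γ^{-1}(i)}*(g'_0,…,g'_n;γ') in G≀Σ_n. Since (g_0,…,g_n;γ)*(δ_i) = δ_{γ^{-1}(i)}, this is exactly identity (2.v) for the face map δ_i. -/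
/-!
STATEMENT 1: identity (2.v) for the face maps `δ_i` in the twisted symmetric
construction `Δφ≀Σ`.
-/

open CategoryTheory SimplexCategory

/-- The operation `δ_i*` of the twisted symmetric construction on a general element
`(g_0,…,g_n;γ)`, defined as `δ_i*(g;γ) = δ_i*(g;id) · δ_i*(e;γ)`, where
`δ_i*(g;id) = (g_0,…,g_{i-1},g_{i+1},…,g_n;id)` and `δ_i*(e;γ) = (e,…,e; δ_i*(γ))`
with `δ_i*(γ)` computed in `Δ𝐒`. -/
def tdel {G : Type} [Group G] (S : SymCSG) {n : ℕ} (x : W G (n + 1)) (i : Fin (n + 2)) :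
    W G n :=
  wmul ((fun j => x.1 ((SimplexCategory.δ i).toOrderHom j)), 1)
       ((fun _ => 1), S.hact (SimplexCategory.δ i) x.2)

theorem toOrderHom_δ_apply {n : ℕ} (i : Fin (n + 2)) (j : Fin (n + 1)) :
    (SimplexCategory.δ i).toOrderHom j = i.succAbove j := rfl

namespace SymCSG

/-- The vertical action on a face map: `γ*(δ_i) = δ_{γ⁻¹(i)}`. -/
theorem vact_δ_apply (S : SymCSG) {n : ℕ} (γ : Equiv.Perm (Fin (n + 2))) (i : Fin (n + 2))
    (j : Fin (n + 1)) :
    (S.vact γ (SimplexCategory.δ i)).toOrderHom j = (γ⁻¹ i).succAbove j := by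
  set v := (S.vact γ (SimplexCategory.δ i)).toOrderHom
  have hv : ∀ k, γ (v k) = i.succAbove (S.hact (SimplexCategory.δ i) γ k) :=
    S.compat γ (SimplexCategory.δ i)
  have hinj : Function.Injective v := fun a b hab =>
    (S.hact (SimplexCategory.δ i) γ).injective
      (Fin.succAbove_right_injective (by rw [← hv, ← hv, hab]))
  have hrange : Set.range v = Set.range (γ⁻¹ i).succAbove := by
    rw [Fin.range_succAbove]
    ext k
    simp only [Set.mem_range, Set.mem_compl_iff, Set.mem_singleton_iff, Equiv.Perm.eq_inv_iff_eq]
    constructor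
    · rintro ⟨a, rfl⟩
      rw [hv]
      exact Fin.succAbove_ne _ _
    · intro hk
      obtain ⟨b, hb⟩ := Fin.exists_succAbove_eq hk
      exact ⟨(S.hact (SimplexCategory.δ i) γ).symm b, γ.injective (by simp [hv, hb])⟩
  exact congrFun (((v.monotone.strictMono_of_injective hinj).range_inj
    (Fin.strictMono_succAbove _)).1 hrange) j

/-- The permutation `δ_i*(γ)` is characterized by `δ_i ∘ δ_i*(γ) = γ ∘ δ_{γ⁻¹(i)}`. -/
theorem succAbove_hact_δ (S : SymCSG) {n : ℕ} (γ : Equiv.Perm (Fin (n + 2))) (i : Fin (n + 2))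
    (j : Fin (n + 1)) :
    i.succAbove (S.hact (SimplexCategory.δ i) γ j) = γ ((γ⁻¹ i).succAbove j) := by
  rw [← S.vact_δ_apply, S.compat, toOrderHom_δ_apply]

theorem hact_δ_mul (S : SymCSG) {n : ℕ} (γ γ' : Equiv.Perm (Fin (n + 2))) (i : Fin (n + 2)) :
    S.hact (SimplexCategory.δ i) (γ * γ') =
      S.hact (SimplexCategory.δ i) γ * S.hact (SimplexCategory.δ (γ⁻¹ i)) γ' := by
  ext1 j
  apply Fin.succAbove_right_injective (p := i)
  simp [succAbove_hact_δ]

theorem succAbove_hact_δ_inv (S : SymCSG) {n : ℕ} (γ : Equiv.Perm (Fin (n + 2)))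
    (i : Fin (n + 2)) (j : Fin (n + 1)) :
    (γ⁻¹ i).succAbove ((S.hact (SimplexCategory.δ i) γ)⁻¹ j) = γ⁻¹ (i.succAbove j) := by
  rw [Equiv.Perm.eq_inv_iff_eq, ← S.succAbove_hact_δ, ← Equiv.Perm.mul_apply,
    mul_inv_cancel, Equiv.Perm.one_apply]

end SymCSG

/-- Identity (2.v) for the face maps in the twisted symmetric construction:
`δ_i*((g;γ)·(g';γ')) = δ_i*(g;γ) · δ_{γ⁻¹(i)}*(g';γ')` in `G ≀ Σ_n`
(recall `(g;γ)*(δ_i) = δ_{γ⁻¹(i)}`). -/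
theorem stmt1 (G : Type) [Group G] (φ : G →* ℤˣ) (S : SymCSG)
    (n : ℕ) (i : Fin (n + 2)) (x y : W G (n + 1)) :
    tdel S (wmul x y) i = wmul (tdel S x i) (tdel S y (x.2⁻¹ i)) := by
  simp only [tdel, wmul, one_mul, mul_one, Prod.mk.injEq]
  refine ⟨funext fun j => ?_, S.hact_δ_mul _ _ _⟩
  simp only [toOrderHom_δ_apply, S.succAbove_hact_δ_inv]
end

section
/- Let (G,φ) be a group with parity, n ≥ 0 and 0 ≤ i ≤ n. For all elements (g_0,…,g_n;γ) and (g'_0,…,g'_n;γ') of G≀Σ_{n+1}, the operation σ_i* of the twisted symmetric construction satisfies σ_i*((g_0,…,g_n;γ)·(g'_0,…,g'_n;γ')) = σ_i*(g_0,…,g_n;γ) · σ_{γ^{-1}(i)}*(g'_0,…,g'_n;γ') in G≀Σ_{n+2}, in all four cases of the parities φ(g_i) and φ(g'_{γ^{-1}(i)}). Since (g_0,…,g_n;γ)*(σ_i) = σ_{γ^{-1}(i)}, this is exactly identity (2.v) for the degeneracy σ_i. -/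
/-!
STATEMENT 2: identity (2.v) for the degeneracies `σ_i` in the twisted symmetric
construction `Δφ≀Σ`, in all four cases of the parities `φ(g_i)`, `φ(g'_{γ⁻¹(i)})`.
-/

open CategoryTheory SimplexCategory

/-- The operation `σ_i*` of the twisted symmetric construction on a general element
`(g_0,…,g_n;γ)`, defined as `σ_i*(g;γ) = σ_i*(g;id) · σ_i*(e;γ)`, where
`σ_i*(g;id) = (g_0,…,g_i,g_i,…,g_n;τ)` with `τ = id` if `φ(g_i) = 1` and
`τ = (i,i+1)` if `φ(g_i) = -1`, and `σ_i*(e;γ) = (e,…,e; σ_i*(γ))` with `σ_i*(γ)`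
computed in `Δ𝐒`. -/
def tsig {G : Type} [Group G] (φ : G →* ℤˣ) (S : SymCSG) {n : ℕ} (x : W G n)
    (i : Fin (n + 1)) : W G (n + 1) :=
  wmul ((fun j => x.1 ((SimplexCategory.σ i).toOrderHom j)),
        if φ (x.1 i) = 1 then 1 else Equiv.swap i.castSucc i.succ)
       ((fun _ => 1), S.hact (SimplexCategory.σ i) x.2)

lemma Fin.predAbove_eq_predAbove_iff {n : ℕ} (i : Fin (n + 1)) (a b : Fin (n + 2)) :
    i.predAbove a = i.predAbove b ↔
      a = b ∨ a = i.castSucc ∧ b = i.succ ∨ a = i.succ ∧ b = i.castSucc := by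
  simp only [Fin.predAbove, Fin.lt_def, Fin.ext_iff, Fin.val_castSucc, Fin.val_succ]
  split_ifs <;> simp <;> omega

lemma Fin.predAbove_swap {n : ℕ} (i : Fin (n + 1)) (a : Fin (n + 2)) :
    i.predAbove (Equiv.swap i.castSucc i.succ a) = i.predAbove a := by
  rw [Fin.predAbove_eq_predAbove_iff]
  rw [Equiv.swap_apply_def]
  split_ifs <;> simp_all

namespace SymCSG

variable (S : SymCSG) {n : ℕ}

/-- In the symmetric crossed simplicial group, `γ*(σ_i) = σ_{γ⁻¹(i)}`. -/
lemma vact_σ (γ : Equiv.Perm (Fin (n + 1))) (i : Fin (n + 1)) :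
    S.vact γ (SimplexCategory.σ i) = SimplexCategory.σ (γ⁻¹ i) := by
  have hc := S.compat γ (SimplexCategory.σ i)
  have hepi : Epi (S.vact γ (SimplexCategory.σ i)) := by
    rw [SimplexCategory.epi_iff_surjective]
    intro j
    obtain ⟨z, hz⟩ := SimplexCategory.epi_iff_surjective.mp
      (inferInstance : Epi (SimplexCategory.σ i)) (γ j)
    refine ⟨(S.hact (SimplexCategory.σ i) γ)⁻¹ z, γ.injective ?_⟩
    rw [← hz]
    exact (hc _).trans (congrArg _ (Equiv.apply_symm_apply _ z))
  obtain ⟨k, hk⟩ := SimplexCategory.eq_σ_of_epi (S.vact γ (SimplexCategory.σ i))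
  rw [hk] at hc ⊢
  change ∀ x : Fin (n + 2),
    γ (k.predAbove x) = i.predAbove (S.hact (SimplexCategory.σ i) γ x) at hc
  have h1 := hc k.castSucc
  have h2 := hc k.succ
  rw [Fin.predAbove_castSucc_self] at h1
  rw [Fin.predAbove_succ_self] at h2
  have h3 : γ k = i := by
    rcases (Fin.predAbove_eq_predAbove_iff i _ _).mp (h1.symm.trans h2) with h | h | h
    · exact absurd ((S.hact _ γ).injective h) (Fin.castSucc_lt_succ).ne
    · rw [h1, h.1, Fin.predAbove_castSucc_self]
    · rw [h2, h.2, Fin.predAbove_castSucc_self]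
  rw [Equiv.Perm.inv_eq_iff_eq.mpr h3.symm]

lemma predAbove_hact_σ (γ : Equiv.Perm (Fin (n + 1))) (i : Fin (n + 1)) (x : Fin (n + 2)) :
    i.predAbove (S.hact (SimplexCategory.σ i) γ x) = γ ((γ⁻¹ i).predAbove x) := by
  have h := S.compat γ (SimplexCategory.σ i) x
  rw [vact_σ] at h
  exact h.symm

lemma hact_σ_castSucc_and_succ (γ : Equiv.Perm (Fin (n + 1))) (i : Fin (n + 1)) :
    S.hact (SimplexCategory.σ i) γ (γ⁻¹ i).castSucc = i.castSucc ∧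
      S.hact (SimplexCategory.σ i) γ (γ⁻¹ i).succ = i.succ := by
  have h1 := S.predAbove_hact_σ γ i (γ⁻¹ i).castSucc
  have h2 := S.predAbove_hact_σ γ i (γ⁻¹ i).succ
  rw [Fin.predAbove_castSucc_self] at h1
  rw [Fin.predAbove_succ_self] at h2
  have hle := S.fiber_mono γ (SimplexCategory.σ i) (γ⁻¹ i).castSucc (γ⁻¹ i).succ (by
    rw [vact_σ]
    change (γ⁻¹ i).predAbove _ = (γ⁻¹ i).predAbove _
    rw [Fin.predAbove_castSucc_self, Fin.predAbove_succ_self]) (Fin.castSucc_lt_succ).le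
  rcases (Fin.predAbove_eq_predAbove_iff i _ _).mp (h1.trans h2.symm) with h | h | h
  · exact absurd ((S.hact _ γ).injective h) (Fin.castSucc_lt_succ).ne
  · exact h
  · rw [h.1, h.2] at hle
    exact absurd hle (Fin.castSucc_lt_succ).not_ge

lemma hact_σ_mul_swap (γ : Equiv.Perm (Fin (n + 1))) (i : Fin (n + 1)) :
    S.hact (SimplexCategory.σ i) γ * Equiv.swap (γ⁻¹ i).castSucc (γ⁻¹ i).succ =
      Equiv.swap i.castSucc i.succ * S.hact (SimplexCategory.σ i) γ := by
  obtain ⟨h1, h2⟩ := S.hact_σ_castSucc_and_succ γ i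
  rw [Equiv.mul_swap_eq_swap_mul, h1, h2]

lemma hact_σ_mul (γ γ' : Equiv.Perm (Fin (n + 1))) (i : Fin (n + 1)) :
    S.hact (SimplexCategory.σ i) (γ * γ') =
      S.hact (SimplexCategory.σ i) γ * S.hact (SimplexCategory.σ (γ⁻¹ i)) γ' := by
  obtain ⟨h1, h2⟩ := S.hact_σ_castSucc_and_succ γ i
  obtain ⟨h1', h2'⟩ := S.hact_σ_castSucc_and_succ γ' (γ⁻¹ i)
  obtain ⟨h3, h4⟩ := S.hact_σ_castSucc_and_succ (γ * γ') i
  rw [mul_inv_rev, Equiv.Perm.mul_apply] at h3 h4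
  set k := γ'⁻¹ (γ⁻¹ i)
  ext1 x
  rw [Equiv.Perm.mul_apply]
  have h := S.predAbove_hact_σ (γ * γ') i x
  have h' := S.predAbove_hact_σ γ i (S.hact (SimplexCategory.σ (γ⁻¹ i)) γ' x)
  rw [S.predAbove_hact_σ γ' (γ⁻¹ i) x] at h'
  rw [mul_inv_rev, Equiv.Perm.mul_apply, Equiv.Perm.mul_apply, ← h'] at h
  rcases (Fin.predAbove_eq_predAbove_iff i _ _).mp h with h | h | h
  · exact h
  · have hx : x = k.castSucc := (S.hact _ (γ * γ')).injective (h.1.trans h3.symm)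
    rw [hx, h1', h1, h3]
  · have hx : x = k.succ := (S.hact _ (γ * γ')).injective (h.1.trans h4.symm)
    rw [hx, h2', h2, h4]

end SymCSG

/-- The permutation `τ` in `σ_i*(g;id)`, written as a function of the parity `u = φ(g_i)`. -/
def parityTwist {n : ℕ} (i : Fin (n + 1)) (u : ℤˣ) : Equiv.Perm (Fin (n + 2)) :=
  if u = 1 then 1 else Equiv.swap i.castSucc i.succ

lemma parityTwist_mul {n : ℕ} (i : Fin (n + 1)) (u v : ℤˣ) :
    parityTwist i (u * v) = parityTwist i u * parityTwist i v := by
  rcases Int.units_eq_one_or u with rfl | rfl <;>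
    rcases Int.units_eq_one_or v with rfl | rfl <;> simp [parityTwist]

lemma predAbove_parityTwist {n : ℕ} (i : Fin (n + 1)) (u : ℤˣ) (a : Fin (n + 2)) :
    i.predAbove (parityTwist i u a) = i.predAbove a := by
  unfold parityTwist
  split_ifs
  · rfl
  · exact Fin.predAbove_swap i a

lemma SymCSG.hact_σ_mul_parityTwist (S : SymCSG) {n : ℕ} (γ : Equiv.Perm (Fin (n + 1)))
    (i : Fin (n + 1)) (u : ℤˣ) :
    S.hact (SimplexCategory.σ i) γ * parityTwist (γ⁻¹ i) u =
      parityTwist i u * S.hact (SimplexCategory.σ i) γ := by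
  unfold parityTwist
  split_ifs
  · rw [mul_one, one_mul]
  · exact S.hact_σ_mul_swap γ i

lemma tsig_eq {G : Type} [Group G] (φ : G →* ℤˣ) (S : SymCSG) {n : ℕ} (x : W G n)
    (i : Fin (n + 1)) :
    tsig φ S x i = (fun j => x.1 (i.predAbove j),
      parityTwist i (φ (x.1 i)) * S.hact (SimplexCategory.σ i) x.2) :=
  Prod.ext (funext fun _ => mul_one _) rfl

/-- Identity (2.v) for the degeneracies in the twisted symmetric construction:
`σ_i*((g;γ)·(g';γ')) = σ_i*(g;γ) · σ_{γ⁻¹(i)}*(g';γ')` in `G ≀ Σ_{n+2}`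
(recall `(g;γ)*(σ_i) = σ_{γ⁻¹(i)}`); this holds in all four cases of the parities
`φ(g_i)` and `φ(g'_{γ⁻¹(i)})`. -/
theorem stmt2 (G : Type) [Group G] (φ : G →* ℤˣ) (S : SymCSG)
    (n : ℕ) (i : Fin (n + 1)) (x y : W G n) :
    tsig φ S (wmul x y) i = wmul (tsig φ S x i) (tsig φ S y (x.2⁻¹ i)) := by
  rw [tsig_eq, tsig_eq, tsig_eq]
  refine Prod.ext (funext fun j => ?_) ?_
  · obtain ⟨j, rfl⟩ :=
      (parityTwist i (φ (x.1 i)) * S.hact (SimplexCategory.σ i) x.2).surjective j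
    simp only [wmul, Equiv.Perm.coe_inv, Equiv.symm_apply_apply]
    rw [Equiv.Perm.mul_apply, predAbove_parityTwist, S.predAbove_hact_σ,
      Equiv.Perm.coe_inv, Equiv.symm_apply_apply]
  · simp only [wmul]
    rw [map_mul, parityTwist_mul, S.hact_σ_mul, mul_assoc, mul_assoc,
      ← mul_assoc (parityTwist i _) (S.hact _ _), ← S.hact_σ_mul_parityTwist, mul_assoc]
end

section
/- Let {G_n}_{n≥0} be a crossed simplicial group, n ≥ 1, g ∈ G_n and 0 ≤ i ≤ n. Then g*(σ_i) is a degeneracy and g*(δ_i) is a face map, and moreover there exists a single index 0 ≤ j ≤ n such that simultaneously g*(σ_i) = σ_j and g*(δ_i) = δ_j; for the same j one also has g*(φ_i) = φ_j, where φ_i: [0] → [n] is the map sending 0 to i. -/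
/-!
STATEMENT 4: in a crossed simplicial group, for `g ∈ G_n` and `0 ≤ i ≤ n`,
`g*(σ_i)` is a degeneracy, `g*(δ_i)` is a face, and there is a single index `j` with
`g*(σ_i) = σ_j`, `g*(δ_i) = δ_j` and `g*(φ_i) = φ_j` simultaneously.
-/

open CategoryTheory SimplexCategory

/-- A crossed simplicial group: a sequence of groups `{G_n}` together with operations
`ψ*(g) ∈ G_m` and `g*(ψ) ∈ Δ([m],[n])` for every `ψ ∈ Δ([m],[n])` and `g ∈ G_n`,
satisfying the six crossed-simplicial-group identities
(1.h), (2.h), (3.h), (1.v), (2.v), (3.v). -/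
structure CSG (G : ℕ → Type) [∀ n, Group (G n)] : Type where
  hact : ∀ {m n : ℕ}, (mk m ⟶ mk n) → G n → G m
  vact : ∀ {m n : ℕ}, G n → (mk m ⟶ mk n) → (mk m ⟶ mk n)
  id1h : ∀ {k m n : ℕ} (ψ : mk m ⟶ mk n) (χ : mk k ⟶ mk m) (g : G n),
    hact (χ ≫ ψ) g = hact χ (hact ψ g)
  id3h₁ : ∀ {n : ℕ} (g : G n), hact (𝟙 (mk n)) g = g
  id3h₂ : ∀ {m n : ℕ} (ψ : mk m ⟶ mk n), hact ψ (1 : G n) = 1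
  id1v : ∀ {m n : ℕ} (g h : G n) (ψ : mk m ⟶ mk n), vact (g * h) ψ = vact h (vact g ψ)
  id3v₁ : ∀ {m n : ℕ} (ψ : mk m ⟶ mk n), vact (1 : G n) ψ = ψ
  id3v₂ : ∀ {n : ℕ} (g : G n), vact g (𝟙 (mk n)) = 𝟙 (mk n)
  id2h : ∀ {k m n : ℕ} (ψ : mk m ⟶ mk n) (χ : mk k ⟶ mk m) (g : G n),
    vact g (χ ≫ ψ) = vact (hact ψ g) χ ≫ vact g ψ
  id2v : ∀ {m n : ℕ} (ψ : mk m ⟶ mk n) (g h : G n),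
    hact ψ (g * h) = hact ψ g * hact (vact g ψ) h

lemma Fin.predAbove_eq_self_of_ne {n : ℕ} {j : Fin (n + 1)} {x y : Fin (n + 2)} (hxy : x ≠ y)
    (h : j.predAbove x = j.predAbove y) : j.predAbove x = j := by
  have hj := Fin.val_castSucc j
  simp only [Fin.predAbove] at h ⊢
  split_ifs at h ⊢ <;>
    simp only [Fin.ext_iff, ne_eq, Fin.val_pred, Fin.coe_castPred] at h hxy ⊢ <;> omega

namespace CSG

open scoped Simplicial

variable {G : ℕ → Type} [∀ n, Group (G n)] (C : CSG G)

/-- The action of `g ∈ G_n` on the points of `[n]`. -/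
def pointMap {n : ℕ} (g : G n) (k : Fin (n + 1)) : Fin (n + 1) :=
  C.vact g (SimplexCategory.const ⦋0⦌ ⦋n⦌ k) 0

lemma vact_const {n : ℕ} (g : G n) (k : Fin (n + 1)) :
    C.vact g (SimplexCategory.const ⦋0⦌ ⦋n⦌ k) =
      SimplexCategory.const ⦋0⦌ ⦋n⦌ (C.pointMap g k) :=
  eq_const_of_zero _

lemma pointMap_mul {n : ℕ} (g h : G n) (k : Fin (n + 1)) :
    C.pointMap (g * h) k = C.pointMap h (C.pointMap g k) := by
  rw [pointMap, id1v, vact_const]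
  rfl

lemma pointMap_one {n : ℕ} (k : Fin (n + 1)) : C.pointMap (1 : G n) k = k := by
  rw [pointMap, id3v₁]
  rfl

lemma pointMap_bijective {n : ℕ} (g : G n) : Function.Bijective (C.pointMap g) :=
  Function.bijective_iff_has_inverse.2 ⟨C.pointMap g⁻¹,
    fun k => by rw [← pointMap_mul, mul_inv_cancel, pointMap_one],
    fun k => by rw [← pointMap_mul, inv_mul_cancel, pointMap_one]⟩

/-- On points, `g*(ψ)` is conjugate to `ψ`. -/
lemma vact_apply_pointMap {m n : ℕ} (g : G n) (ψ : ⦋m⦌ ⟶ ⦋n⦌) (k : Fin (m + 1)) :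
    C.vact g ψ (C.pointMap (C.hact ψ g) k) = C.pointMap g (ψ k) := by
  have h := C.id2h ψ (SimplexCategory.const ⦋0⦌ ⦋m⦌ k) g
  rw [const_comp, vact_const, vact_const, const_comp] at h
  exact (congrArg (fun f : ⦋0⦌ ⟶ ⦋n⦌ => f 0) h).symm

lemma mono_vact {m n : ℕ} (g : G n) (ψ : ⦋m⦌ ⟶ ⦋n⦌) [Mono ψ] : Mono (C.vact g ψ) := by
  rw [SimplexCategory.mono_iff_injective]
  intro a b hab
  obtain ⟨a, rfl⟩ := (C.pointMap_bijective (C.hact ψ g)).2 a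
  obtain ⟨b, rfl⟩ := (C.pointMap_bijective (C.hact ψ g)).2 b
  have h : C.pointMap g (ψ a) = C.pointMap g (ψ b) := by
    rw [← vact_apply_pointMap, ← vact_apply_pointMap]
    exact hab
  rw [SimplexCategory.mono_iff_injective.1 ‹Mono ψ› ((C.pointMap_bijective g).1 h)]

lemma epi_vact {m n : ℕ} (g : G n) (ψ : ⦋m⦌ ⟶ ⦋n⦌) [Epi ψ] : Epi (C.vact g ψ) := by
  rw [SimplexCategory.epi_iff_surjective]
  intro b
  obtain ⟨b, rfl⟩ := (C.pointMap_bijective g).2 b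
  obtain ⟨a, rfl⟩ := SimplexCategory.epi_iff_surjective.1 ‹Epi ψ› b
  exact ⟨_, C.vact_apply_pointMap g ψ a⟩

lemma vact_δ {n : ℕ} (g : G (n + 1)) (i : Fin (n + 2)) :
    C.vact g (SimplexCategory.δ i) = SimplexCategory.δ (C.pointMap g i) := by
  have := C.mono_vact g (SimplexCategory.δ i)
  obtain ⟨j, hj⟩ := eq_δ_of_mono (C.vact g (SimplexCategory.δ i))
  suffices C.pointMap g i = j by rw [hj, this]
  by_contra hne
  obtain ⟨a, ha⟩ := Fin.exists_succAbove_eq hne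
  obtain ⟨a, rfl⟩ := (C.pointMap_bijective (C.hact (SimplexCategory.δ i) g)).2 a
  have h := C.vact_apply_pointMap g (SimplexCategory.δ i) a
  rw [hj] at h
  exact Fin.succAbove_ne i a ((C.pointMap_bijective g).1 (h.symm.trans ha))

lemma vact_σ {n : ℕ} (g : G n) (i : Fin (n + 1)) :
    C.vact g (SimplexCategory.σ i) = SimplexCategory.σ (C.pointMap g i) := by
  have := C.epi_vact g (SimplexCategory.σ i)
  obtain ⟨j, hj⟩ := eq_σ_of_epi (C.vact g (SimplexCategory.σ i))
  suffices C.pointMap g i = j by rw [hj, this]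
  have h₁ := C.vact_apply_pointMap g (SimplexCategory.σ i) i.castSucc
  have h₂ := C.vact_apply_pointMap g (SimplexCategory.σ i) i.succ
  rw [hj] at h₁ h₂
  replace h₁ := h₁.trans (congrArg (C.pointMap g) (Fin.predAbove_castSucc_self i))
  replace h₂ := h₂.trans (congrArg (C.pointMap g) (Fin.predAbove_succ_self i))
  have hne := (C.pointMap_bijective (C.hact (SimplexCategory.σ i) g)).1.ne
    (Fin.castSucc_lt_succ (i := i)).ne
  exact h₁.symm.trans (Fin.predAbove_eq_self_of_ne hne (h₁.trans h₂.symm))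

end CSG

/-- For a crossed simplicial group `{G_n}`, `n = m+1 ≥ 1`, `g ∈ G_n` and `0 ≤ i ≤ n`,
there exists a single index `0 ≤ j ≤ n` with `g*(σ_i) = σ_j`, `g*(δ_i) = δ_j`, and
`g*(φ_i) = φ_j`, where `φ_i : [0] → [n]` is the map sending `0` to `i`. -/
theorem stmt4 (G : ℕ → Type) [∀ n, Group (G n)] (C : CSG G) (m : ℕ)
    (g : G (m + 1)) (i : Fin (m + 2)) :
    ∃ j : Fin (m + 2),
      C.vact g (SimplexCategory.σ i) = SimplexCategory.σ j ∧
      C.vact g (SimplexCategory.δ i) = SimplexCategory.δ j ∧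
      C.vact g (SimplexCategory.const (mk 0) (mk (m + 1)) i)
        = SimplexCategory.const (mk 0) (mk (m + 1)) j := by
  exact ⟨C.pointMap g i, C.vact_σ g i, C.vact_δ g i, C.vact_const g i⟩
end

section
/- Let {G_n}_{n≥0} be a crossed simplicial group. For every n ≥ 0, the map L_n: G_n → G₀≀Σ_{n+1} defined by L_n(g) = (φ₀*(g), φ₁*(g), …, φ_n*(g); θ_g) satisfies L_n(gh) = L_n(g)·L_n(h) for all g,h ∈ G_n, where the multiplication on G₀≀Σ_{n+1} is the wreath-product multiplication (a_0,…,a_n;α)·(b_0,…,b_n;β) = (a_0 b_{α^{-1}(0)},…,a_n b_{α^{-1}(n)}; αβ); i.e., L_n is a group homomorphism. -/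
/-!
STATEMENT 6: the map `L_n : G_n → G₀ ≀ Σ_{n+1}`, `L_n(g) = (φ₀*(g),…,φ_n*(g); θ_g)`
is a group homomorphism for the wreath-product multiplication.
-/

open CategoryTheory SimplexCategory

/-- `L_n(g) = (φ₀*(g), φ₁*(g), …, φ_n*(g); θ_g)`, where `φ_i : [0] → [n]` sends `0` to
`i` and `θ_g` is the permutation associated to `g`. -/
def Lfun {G : ℕ → Type} [∀ n, Group (G n)] (C : CSG G) (n : ℕ) (g : G n)
    (θ : Equiv.Perm (Fin (n + 1))) : W (G 0) n :=
  (fun i => C.hact (SimplexCategory.const (mk 0) (mk n) i) g, θ)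

/-- `L_n` is a group homomorphism: `L_n(gh) = L_n(g) · L_n(h)` in `G₀ ≀ Σ_{n+1}`.
Here `θ_g` is characterized by `g*(φ_i) = φ_{θ_g⁻¹(i)}`. -/
theorem stmt6 (G : ℕ → Type) [∀ n, Group (G n)] (C : CSG G) (n : ℕ)
    (g h : G n) (θg θh θgh : Equiv.Perm (Fin (n + 1)))
    (hθg : ∀ i : Fin (n + 1), C.vact g (SimplexCategory.const (mk 0) (mk n) i)
      = SimplexCategory.const (mk 0) (mk n) (θg⁻¹ i))
    (hθh : ∀ i : Fin (n + 1), C.vact h (SimplexCategory.const (mk 0) (mk n) i)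
      = SimplexCategory.const (mk 0) (mk n) (θh⁻¹ i))
    (hθgh : ∀ i : Fin (n + 1), C.vact (g * h) (SimplexCategory.const (mk 0) (mk n) i)
      = SimplexCategory.const (mk 0) (mk n) (θgh⁻¹ i)) :
    Lfun C n (g * h) θgh = wmul (Lfun C n g θg) (Lfun C n h θh) := by
  have const_inj : ∀ i j : Fin (n + 1),
      SimplexCategory.const (mk 0) (mk n) i = SimplexCategory.const (mk 0) (mk n) j → i = j :=
    fun i j hij => congrArg (fun f : mk 0 ⟶ mk n => f.toOrderHom 0) hij
  have hθ : θgh = θg * θh := by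
    refine inv_injective (Equiv.ext fun i => const_inj _ _ ?_)
    rw [← hθgh, C.id1v, hθg, hθh, mul_inv_rev, Equiv.Perm.mul_apply]
  refine Prod.ext (funext fun i => ?_) hθ
  simp only [Lfun, wmul]
  rw [C.id2v, hθg]
end

section
/- Let {G_n}_{n≥0} be a crossed simplicial group, n ≥ 1, g ∈ G_n and 0 ≤ i ≤ n. Then θ_{δ_i*(g)} = δ_i*(θ_g) in Σ_n, where the right-hand side δ_i*(θ_g) is computed in the symmetric crossed simplicial group Δ𝐒. -/
/-!
STATEMENT 8: in a crossed simplicial group, `θ_{δ_i*(g)} = δ_i*(θ_g)`, the right-hand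
side being computed in the symmetric crossed simplicial group `Δ𝐒`.
-/

open CategoryTheory SimplexCategory

/-- In `Δ𝐒`, the vertical action on faces is `γ*(δ_i) = δ_{γ⁻¹(i)}`. -/
lemma SymCSG.vact_δ (S : SymCSG) {m : ℕ} (γ : Equiv.Perm (Fin (m + 2))) (i : Fin (m + 2)) :
    S.vact γ (SimplexCategory.δ i) = SimplexCategory.δ (γ⁻¹ i) := by
  have compat : ∀ x : Fin (m + 1), γ ((S.vact γ (SimplexCategory.δ i)).toOrderHom x)
      = i.succAbove (S.hact (SimplexCategory.δ i) γ x) := S.compat γ (SimplexCategory.δ i)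
  have : Mono (S.vact γ (SimplexCategory.δ i)) := by
    rw [SimplexCategory.mono_iff_injective]
    intro x y h
    have hxy : i.succAbove (S.hact (SimplexCategory.δ i) γ x)
        = i.succAbove (S.hact (SimplexCategory.δ i) γ y) := by
      rw [← compat, ← compat]
      exact congrArg γ h
    exact (S.hact (SimplexCategory.δ i) γ).injective (Fin.succAbove_right_injective hxy)
  obtain ⟨a, ha⟩ := SimplexCategory.eq_δ_of_mono (S.vact γ (SimplexCategory.δ i))
  rw [ha] at compat ⊢
  congr 1
  by_contra hne
  obtain ⟨x, hx⟩ := Fin.exists_succAbove_eq (Ne.symm hne)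
  refine Fin.succAbove_ne i (S.hact (SimplexCategory.δ i) γ x) ?_
  rw [← compat x]
  change γ (a.succAbove x) = i
  rw [hx]
  exact γ.apply_symm_apply i

/-- If `g*(δ_j) = δ_{θ⁻¹(j)}` for all `j`, then `g` acts on the vertices `[0] ⟶ [n]`
through `θ⁻¹` as well. -/
lemma CSG.vact_const_s8 {G : ℕ → Type} [∀ n, Group (G n)] (C : CSG G) {m : ℕ} (g : G (m + 1))
    (θ : Equiv.Perm (Fin (m + 2)))
    (hθ : ∀ j : Fin (m + 2), C.vact g (SimplexCategory.δ j) = SimplexCategory.δ (θ⁻¹ j))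
    (x : Fin (m + 2)) :
    (C.vact g (SimplexCategory.const (SimplexCategory.mk 0) (SimplexCategory.mk (m + 1)) x)).toOrderHom 0 = θ⁻¹ x := by
  by_contra hne
  set p : Fin (m + 2) := (C.vact g (SimplexCategory.const (SimplexCategory.mk 0) (SimplexCategory.mk (m + 1)) x)).toOrderHom 0
    with hp
  have hx : x ≠ θ p := fun h => hne (by rw [h]; exact (θ.symm_apply_apply p).symm)
  obtain ⟨k, hk⟩ := Fin.exists_succAbove_eq hx
  have hfac : SimplexCategory.const (SimplexCategory.mk 0) (SimplexCategory.mk (m + 1)) x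
      = SimplexCategory.const (SimplexCategory.mk 0) (SimplexCategory.mk m) k ≫ SimplexCategory.δ (θ p) := by
    rw [SimplexCategory.const_comp, ← hk]
    rfl
  have hinv : θ⁻¹ (θ p) = p := θ.symm_apply_apply p
  rw [hfac, C.id2h, hθ, hinv] at hp
  exact Fin.succAbove_ne p _ hp.symm

/-- For `g ∈ G_n` (`n = m+1 ≥ 1`) and `0 ≤ i ≤ n`: `θ_{δ_i*(g)} = δ_i*(θ_g)` in `Σ_n`.
Here `θ_g` is characterized by `g*(δ_j) = δ_{θ_g⁻¹(j)}`, and `θ_{δ_i*(g)}` is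
characterized (equivalently) by `(δ_i*(g))*(φ_j) = φ_{θ⁻¹(j)}` with `φ_j : [0] → [n-1]`
the map sending `0` to `j`. -/
theorem stmt8 (G : ℕ → Type) [∀ n, Group (G n)] (C : CSG G) (S : SymCSG)
    (m : ℕ) (g : G (m + 1)) (i : Fin (m + 2))
    (θg : Equiv.Perm (Fin (m + 2))) (θ' : Equiv.Perm (Fin (m + 1)))
    (hθg : ∀ j : Fin (m + 2), C.vact g (SimplexCategory.δ j) = SimplexCategory.δ (θg⁻¹ j))
    (hθ' : ∀ j : Fin (m + 1),
      C.vact (C.hact (SimplexCategory.δ i) g) (SimplexCategory.const (mk 0) (mk m) j)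
        = SimplexCategory.const (mk 0) (mk m) (θ'⁻¹ j)) :
    θ' = S.hact (SimplexCategory.δ i) θg := by
  have key (x : Fin (m + 1)) :
      θg ((θg⁻¹ i).succAbove x) = i.succAbove (θ' x) := by
    have h := C.vact_const_s8 g θg hθg (i.succAbove (θ' x))
    have hfac : SimplexCategory.const (mk 0) (mk (m + 1)) (i.succAbove (θ' x))
        = SimplexCategory.const (mk 0) (mk m) (θ' x) ≫ SimplexCategory.δ i := by
      rw [SimplexCategory.const_comp]
      rfl
    have hinv : θ'⁻¹ (θ' x) = x := θ'.symm_apply_apply x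
    rw [hfac, C.id2h, hθg, hθ', hinv] at h
    change (θg⁻¹ i).succAbove x = _ at h
    rw [h]
    exact θg.apply_symm_apply _
  ext1 x
  have h := S.compat θg (SimplexCategory.δ i) x
  rw [S.vact_δ] at h
  exact Fin.succAbove_right_injective ((key x).symm.trans h)
end

section
/- Let {G_n}_{n≥0} be a crossed simplicial group with canonical parity λ₀: G₀ → C₂, let n ≥ 0, g ∈ G_n and 0 ≤ i ≤ n. Then θ_{σ_i*(g)} = τ ∘ σ_i*(θ_g) in Σ_{n+2}, where σ_i*(θ_g) is computed in the symmetric crossed simplicial group Δ𝐒, and τ = id if λ₀(φ_i*(g)) = 1 while τ = (i, i+1) if λ₀(φ_i*(g)) = −1, with φ_i: [0] → [n] the map sending 0 to i. -/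
/-!
STATEMENT 9: in a crossed simplicial group with canonical parity `λ₀ : G₀ → C₂`,
`θ_{σ_i*(g)} = τ ∘ σ_i*(θ_g)` in `Σ_{n+2}`, where `σ_i*(θ_g)` is computed in `Δ𝐒` and
`τ = id` if `λ₀(φ_i*(g)) = 1`, `τ = (i,i+1)` if `λ₀(φ_i*(g)) = -1`.
-/

open CategoryTheory SimplexCategory

theorem const_toOrderHom_apply {m n : ℕ} (v : Fin (n + 1)) (x : Fin (m + 1)) :
    (SimplexCategory.const (mk m) (mk n) v).toOrderHom x = v := rfl

theorem const_comp_eq {m n : ℕ} (ψ : mk m ⟶ mk n) (x : Fin (m + 1)) :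
    SimplexCategory.const (mk 0) (mk m) x ≫ ψ
      = SimplexCategory.const (mk 0) (mk n) (ψ.toOrderHom x) := by
  ext; rfl

theorem sigma_castSucc {n : ℕ} (i : Fin (n + 1)) :
    (SimplexCategory.σ i).toOrderHom i.castSucc = i := Fin.predAbove_castSucc_self i

theorem sigma_succ {n : ℕ} (i : Fin (n + 1)) :
    (SimplexCategory.σ i).toOrderHom i.succ = i := Fin.predAbove_succ_self i

/-- The only nontrivial fiber of `σ_i` is `{i, i + 1}`. -/
theorem eq_or_of_sigma_eq {n : ℕ} {i : Fin (n + 1)} {x y : Fin (n + 2)}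
    (h : (SimplexCategory.σ i).toOrderHom x = (SimplexCategory.σ i).toOrderHom y) :
    x = y ∨ (x = i.castSucc ∧ y = i.succ) ∨ (x = i.succ ∧ y = i.castSucc) := by
  change i.predAbove x = i.predAbove y at h
  simp only [Fin.predAbove, Fin.lt_def, Fin.ext_iff] at h ⊢
  split_ifs at h <;> simp at h ⊢ <;> simp_all <;> omega

/-- A permutation preserving the fibers of `σ_i` is trivial or the transposition `(i, i + 1)`. -/
theorem eq_one_or_swap_of_sigma {n : ℕ} {i : Fin (n + 1)} (ρ : Equiv.Perm (Fin (n + 2)))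
    (h : ∀ x, (SimplexCategory.σ i).toOrderHom (ρ x) = (SimplexCategory.σ i).toOrderHom x) :
    ρ = 1 ∨ ρ = Equiv.swap i.castSucc i.succ := by
  have hne : i.castSucc ≠ i.succ := Fin.castSucc_lt_succ.ne
  have key := fun x => eq_or_of_sigma_eq (h x)
  have hinj := ρ.injective
  by_cases hi : ρ i.castSucc = i.castSucc
  · left
    ext1 x
    rw [Equiv.Perm.one_apply]
    rcases key x with hx | ⟨hx, rfl⟩ | ⟨hx, rfl⟩
    · exact hx
    · exact absurd (hinj (hx.trans hi.symm)) hne.symm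
    · exact hi
  · right
    have h₁ : ρ i.castSucc = i.succ := by
      rcases key i.castSucc with hx | ⟨_, hy⟩ | ⟨hx, _⟩
      · exact absurd hx hi
      · exact absurd hy hne
      · exact hx
    have h₂ : ρ i.succ = i.castSucc := by
      rcases key i.succ with hx | ⟨hx, _⟩ | ⟨_, hy⟩
      · exact absurd (hinj (h₁.trans hx.symm)) hne
      · exact hx
      · exact absurd hy hne.symm
    ext1 x
    by_cases hx₁ : x = i.castSucc
    · rw [hx₁, h₁, Equiv.swap_apply_left]
    by_cases hx₂ : x = i.succ
    · rw [hx₂, h₂, Equiv.swap_apply_right]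
    rw [Equiv.swap_apply_of_ne_of_ne hx₁ hx₂]
    rcases key x with hx | ⟨_, hx⟩ | ⟨_, hx⟩
    · exact hx
    · exact absurd hx hx₂
    · exact absurd hx hx₁

section

variable {G : ℕ → Type} [∀ n, Group (G n)] (C : CSG G)

/-- The action on faces determines the action on vertices. -/
theorem vact_const_of_vact_delta {n : ℕ} (h : G (n + 1)) (θ : Equiv.Perm (Fin (n + 2)))
    (hθ : ∀ j : Fin (n + 2), C.vact h (SimplexCategory.δ j) = SimplexCategory.δ (θ⁻¹ j))
    (k : Fin (n + 2)) :
    C.vact h (SimplexCategory.const (mk 0) (mk (n + 1)) k)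
      = SimplexCategory.const (mk 0) (mk (n + 1)) (θ⁻¹ k) := by
  obtain ⟨v, hv⟩ : ∃ v, C.vact h (SimplexCategory.const (mk 0) (mk (n + 1)) k)
      = SimplexCategory.const (mk 0) (mk (n + 1)) v := ⟨_, eq_const_of_zero _⟩
  rw [hv]
  by_contra hne
  have hk : θ v ≠ k := by
    rintro rfl
    simp at hne
  obtain ⟨l, hl⟩ := Fin.exists_succAbove_eq hk.symm
  have hcomp : SimplexCategory.const (mk 0) (mk n) l ≫ SimplexCategory.δ (θ v)
      = SimplexCategory.const (mk 0) (mk (n + 1)) k := by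
    rw [const_comp_eq]
    exact congrArg _ hl
  have h2 := C.id2h (SimplexCategory.δ (θ v)) (SimplexCategory.const (mk 0) (mk n) l) h
  rw [hcomp, hv, hθ, show θ⁻¹ (θ v) = v from θ.symm_apply_apply v, eq_const_of_zero (C.vact _ _),
    const_comp_eq] at h2
  have h3 := congrArg (fun f => f.toOrderHom 0) h2
  exact Fin.succAbove_ne v _ h3.symm

/-- If `g` and `ψ*(g)` act on vertices through `θ⁻¹` and `θ'⁻¹`, then `θ ∘ g*(ψ) = ψ ∘ θ'`. -/
theorem perm_vact_apply {m n : ℕ} (g : G n) (ψ : mk m ⟶ mk n)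
    (θ : Equiv.Perm (Fin (n + 1))) (θ' : Equiv.Perm (Fin (m + 1)))
    (hθ : ∀ j, C.vact g (SimplexCategory.const (mk 0) (mk n) j)
      = SimplexCategory.const (mk 0) (mk n) (θ⁻¹ j))
    (hθ' : ∀ j, C.vact (C.hact ψ g) (SimplexCategory.const (mk 0) (mk m) j)
      = SimplexCategory.const (mk 0) (mk m) (θ'⁻¹ j)) (x : Fin (m + 1)) :
    θ ((C.vact g ψ).toOrderHom x) = ψ.toOrderHom (θ' x) := by
  have h := C.id2h ψ (SimplexCategory.const (mk 0) (mk m) (θ' x)) g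
  rw [const_comp_eq, hθ, hθ', const_comp_eq,
    show θ'⁻¹ (θ' x) = x from θ'.symm_apply_apply x] at h
  have h' := congrArg (fun f => f.toOrderHom 0) h
  simp only [const_toOrderHom_apply] at h'
  rw [← h']
  exact θ.apply_symm_apply _

/-- The vertices of the edge `e` are permuted according to the action of `e*(h)` on `[1]`. -/
theorem perm_inv_edge {m : ℕ} (h : G m) (e : mk 1 ⟶ mk m) (θ : Equiv.Perm (Fin (m + 1)))
    (hθ : ∀ j, C.vact h (SimplexCategory.const (mk 0) (mk m) j)
      = SimplexCategory.const (mk 0) (mk m) (θ⁻¹ j)) (x : Fin 2) :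
    θ⁻¹ (e.toOrderHom x) = (C.vact h e).toOrderHom
      ((C.vact (C.hact e h) (SimplexCategory.const (mk 0) (mk 1) x)).toOrderHom 0) := by
  have h2 := C.id2h e (SimplexCategory.const (mk 0) (mk 1) x) h
  rw [const_comp_eq, hθ] at h2
  exact congrArg (fun f => f.toOrderHom 0) h2

theorem parity_edge_cases {lam : G 0 → ℤˣ}
    (hlam : ∀ g : G 0,
      (C.vact (C.hact (SimplexCategory.σ (0 : Fin 1)) g) (SimplexCategory.δ (0 : Fin 2))
          = SimplexCategory.δ (0 : Fin 2) → lam g = 1) ∧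
      (C.vact (C.hact (SimplexCategory.σ (0 : Fin 1)) g) (SimplexCategory.δ (0 : Fin 2))
          = SimplexCategory.δ (1 : Fin 2) → lam g = -1))
    {m n : ℕ} (g : G n) (ψ : mk m ⟶ mk n) (e : mk 1 ⟶ mk m) (i : Fin (n + 1))
    (he : e ≫ ψ = SimplexCategory.σ (0 : Fin 1) ≫ SimplexCategory.const (mk 0) (mk n) i)
    (θ : Equiv.Perm (Fin (m + 1)))
    (hθ : ∀ j, C.vact (C.hact ψ g) (SimplexCategory.const (mk 0) (mk m) j)
      = SimplexCategory.const (mk 0) (mk m) (θ⁻¹ j)) :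
    (lam (C.hact (SimplexCategory.const (mk 0) (mk n) i) g) = 1 ∧
      θ⁻¹ (e.toOrderHom 0) ≤ θ⁻¹ (e.toOrderHom 1)) ∨
    (lam (C.hact (SimplexCategory.const (mk 0) (mk n) i) g) = -1 ∧
      θ⁻¹ (e.toOrderHom 1) ≤ θ⁻¹ (e.toOrderHom 0)) := by
  have hq : C.hact e (C.hact ψ g) = C.hact (SimplexCategory.σ (0 : Fin 1))
      (C.hact (SimplexCategory.const (mk 0) (mk n) i) g) := by
    rw [← C.id1h, ← C.id1h, he]
  have hδ₀ : SimplexCategory.δ (0 : Fin 2) = SimplexCategory.const (mk 0) (mk 1) 1 :=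
    eq_const_of_zero _
  have hδ₁ : SimplexCategory.δ (1 : Fin 2) = SimplexCategory.const (mk 0) (mk 1) 0 :=
    eq_const_of_zero _
  have hl := hlam (C.hact (SimplexCategory.const (mk 0) (mk n) i) g)
  rw [← hq, hδ₀, hδ₁] at hl
  have h₀ := perm_inv_edge C _ e θ hθ 0
  have h₁ := perm_inv_edge C _ e θ hθ 1
  rw [h₀, h₁]
  obtain ⟨v, hv⟩ : ∃ v, C.vact (C.hact e (C.hact ψ g))
      (SimplexCategory.const (mk 0) (mk 1) 1) = SimplexCategory.const (mk 0) (mk 1) v :=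
    ⟨_, eq_const_of_zero _⟩
  rw [hv] at hl ⊢
  rw [const_toOrderHom_apply]
  obtain rfl | rfl : v = 0 ∨ v = 1 := by
    have : v.val < 2 := v.isLt
    simp only [Fin.ext_iff]
    change v.val = 0 ∨ v.val = 1
    omega
  · exact Or.inr ⟨hl.2 rfl, (C.vact (C.hact ψ g) e).toOrderHom.monotone (Fin.zero_le _)⟩
  · exact Or.inl ⟨hl.1 rfl, (C.vact (C.hact ψ g) e).toOrderHom.monotone (Fin.le_last _)⟩

end

theorem stmt9 (G : ℕ → Type) [∀ n, Group (G n)] (C : CSG G) (S : SymCSG)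
    -- `lam` is the canonical parity `λ₀ : G₀ → C₂`:
    (lam : G 0 → ℤˣ)
    (hlam : ∀ g : G 0,
      (C.vact (C.hact (SimplexCategory.σ (0 : Fin 1)) g) (SimplexCategory.δ (0 : Fin 2))
          = SimplexCategory.δ (0 : Fin 2) → lam g = 1) ∧
      (C.vact (C.hact (SimplexCategory.σ (0 : Fin 1)) g) (SimplexCategory.δ (0 : Fin 2))
          = SimplexCategory.δ (1 : Fin 2) → lam g = -1))
    (n : ℕ) (g : G n) (i : Fin (n + 1))
    -- `θ_g`, characterized (equivalently) by `g*(φ_j) = φ_{θ_g⁻¹(j)}`: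
    (θg : Equiv.Perm (Fin (n + 1)))
    (hθg : ∀ j : Fin (n + 1), C.vact g (SimplexCategory.const (mk 0) (mk n) j)
      = SimplexCategory.const (mk 0) (mk n) (θg⁻¹ j))
    -- `θ_{σ_i*(g)}`, characterized by `(σ_i*(g))*(δ_j) = δ_{θ⁻¹(j)}`:
    (θ' : Equiv.Perm (Fin (n + 2)))
    (hθ' : ∀ j : Fin (n + 2), C.vact (C.hact (SimplexCategory.σ i) g) (SimplexCategory.δ j)
      = SimplexCategory.δ (θ'⁻¹ j)) :
    θ' = (if lam (C.hact (SimplexCategory.const (mk 0) (mk n) i) g) = 1 then 1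
          else Equiv.swap i.castSucc i.succ) * S.hact (SimplexCategory.σ i) θg := by
  have hvert := vact_const_of_vact_delta C _ θ' hθ'
  have ha := perm_vact_apply C g (SimplexCategory.σ i) θg θ' hθg hvert
  have hb := S.compat θg (SimplexCategory.σ i)
  have hmono := S.fiber_mono θg (SimplexCategory.σ i)
  set s := S.hact (SimplexCategory.σ i) θg
  have ha' : (C.vact g (SimplexCategory.σ i)).toOrderHom
      = (⇑θg⁻¹ ∘ (SimplexCategory.σ i).toOrderHom) ∘ θ' := by
    funext x
    simp [← ha x]
  have hb' : (S.vact θg (SimplexCategory.σ i)).toOrderHom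
      = (⇑θg⁻¹ ∘ (SimplexCategory.σ i).toOrderHom) ∘ s := by
    funext x
    simp [← hb x]
  have hab := Tuple.unique_monotone
    (ha' ▸ (C.vact g (SimplexCategory.σ i)).toOrderHom.monotone)
    (hb' ▸ (S.vact θg (SimplexCategory.σ i)).toOrderHom.monotone)
  have hρ := eq_one_or_swap_of_sigma (i := i) (θ' * s⁻¹) fun x => by
    have := congrFun hab (s⁻¹ x)
    simpa using this
  have hlt : i.castSucc < i.succ := Fin.castSucc_lt_succ
  have hs_lt : s⁻¹ i.castSucc < s⁻¹ i.succ := by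
    by_contra! hle
    have := hmono _ _ (θg.injective (by
      rw [hb, hb]
      simp [sigma_castSucc, sigma_succ])) hle
    rw [show s (s⁻¹ _) = _ from s.apply_symm_apply _,
      show s (s⁻¹ _) = _ from s.apply_symm_apply _] at this
    exact this.not_gt hlt
  let e : mk 1 ⟶ mk (n + 1) := mkHom ⟨![i.castSucc, i.succ], by
    rw [Fin.monotone_iff_le_succ]
    intro j
    rw [Subsingleton.elim j 0]
    exact hlt.le⟩
  have he : e ≫ SimplexCategory.σ i
      = SimplexCategory.σ (0 : Fin 1) ≫ SimplexCategory.const (mk 0) (mk n) i := by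
    ext x : 3
    change Fin 2 at x
    fin_cases x
    · exact sigma_castSucc i
    · exact sigma_succ i
  have hcases := parity_edge_cases C hlam g (SimplexCategory.σ i) e i he θ' hvert
  change (_ ∧ θ'⁻¹ i.castSucc ≤ θ'⁻¹ i.succ) ∨ (_ ∧ θ'⁻¹ i.succ ≤ θ'⁻¹ i.castSucc) at hcases
  rw [← mul_inv_eq_iff_eq_mul]
  rcases hcases with ⟨hl, hle⟩ | ⟨hl, hle⟩
  · rw [if_pos hl]
    refine hρ.resolve_right fun h => ?_
    rw [mul_inv_eq_iff_eq_mul.mp h, mul_inv_rev, Equiv.swap_inv] at hle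
    simp only [Equiv.Perm.mul_apply, Equiv.swap_apply_left, Equiv.swap_apply_right] at hle
    exact hle.not_gt hs_lt
  · rw [if_neg (by rw [hl]; decide)]
    refine hρ.resolve_left fun h => ?_
    rw [mul_inv_eq_one.mp h] at hle
    exact hle.not_gt hs_lt
end

section
/- Let (ΔG, I) be a self-dual crossed simplicial group and H any group. Then the crossed simplicial group ΔG × H is self-dual: the assignment Ī which is the identity on objects and sends a morphism φ∘(g,h) (with φ ∈ Δ([n],[m]), g ∈ G_n, h ∈ H, using the unique factorization in ΔG × H) to (I(g), h^{-1}) ∘ I(φ) is a well-defined functor Ī: (ΔG × H)^{op} → ΔG × H (i.e., it preserves identities and compositions), and Ī ∘ Ī^{op} = id. -/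
/-!
STATEMENT 11: if `(ΔG, I)` is a self-dual crossed simplicial group and `H` is a group,
then `ΔG × H` is self-dual: the assignment `Ī(φ∘(g,h)) = (I(g), h⁻¹) ∘ I(φ)` is a
well-defined functor `(ΔG × H)^op → ΔG × H` and `Ī ∘ Ī^op = id`.
-/

open CategoryTheory SimplexCategory

/-- Hom-sets of the category `ΔG`: `Hom([k],[n]) := Δ([k],[n]) × G_k`, a morphism
`(φ,g)` being the composite `φ∘g` of the automorphism `g` followed by the
order-preserving map `φ`. -/
abbrev CH (G : ℕ → Type) (k n : ℕ) : Type := (mk k ⟶ mk n) × G k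

/-- Composition in `ΔG`: `(φ,g)∘(ψ,h) := (φ∘(g*(ψ)), h·(ψ*(g)))`, where `(ψ,h)` is the
first morphism and `(φ,g)` the second. -/
def ccomp {G : ℕ → Type} [∀ n, Group (G n)] (C : CSG G)
    {k m n : ℕ} (f : CH G m n) (u : CH G k m) : CH G k n :=
  (C.vact f.2 u.1 ≫ f.1, u.2 * C.hact u.1 f.2)

/-- Hom-sets of the category `ΔG × H`. -/
abbrev CH2 (G : ℕ → Type) (H : Type) (k n : ℕ) : Type := (mk k ⟶ mk n) × (G k × H)

/-- Composition in `ΔG × H`, induced by the crossed simplicial structure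
`ψ*(g,h) = (ψ*(g), h)`, `(g,h)*(ψ) = g*(ψ)` of `ΔG × H`. -/
def ccomp2 {G : ℕ → Type} [∀ n, Group (G n)] (C : CSG G) (H : Type) [Group H]
    {k m n : ℕ} (f : CH2 G H m n) (u : CH2 G H k m) : CH2 G H k n :=
  (C.vact f.2.1 u.1 ≫ f.1, (u.2.1 * C.hact u.1 f.2.1, u.2.2 * f.2.2))

/-- The duality `Ī` of `ΔG × H`: using the unique factorization of a morphism of
`ΔG × H` as `φ∘(g,h)`, it is given by `Ī(φ∘(g,h)) := (I(g), h⁻¹) ∘ I(φ)`, where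
`I(g)` denotes the value of `I` on the automorphism `g` and `I(φ)` its value on the
order-preserving map `φ`. -/
def Ibar {G : ℕ → Type} [∀ n, Group (G n)] (C : CSG G) (H : Type) [Group H]
    (I : ∀ {k n : ℕ}, CH G k n → CH G n k)
    {k n : ℕ} (f : CH2 G H k n) : CH2 G H n k :=
  ccomp2 C H
    ((I ((𝟙 (mk k) : mk k ⟶ mk k), f.2.1)).1, ((I ((𝟙 (mk k) : mk k ⟶ mk k), f.2.1)).2, f.2.2⁻¹))
    ((I (f.1, (1 : G k))).1, ((I (f.1, (1 : G k))).2, (1 : H)))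

theorem ccomp_factorization {G : ℕ → Type} [∀ n, Group (G n)] (C : CSG G)
    {k n : ℕ} (f : CH G k n) :
    ccomp C (f.1, (1 : G k)) ((𝟙 (mk k) : mk k ⟶ mk k), f.2) = f := by
  simp [ccomp, C.id3v₂, C.id3h₁]

theorem Ibar_eq {G : ℕ → Type} [∀ n, Group (G n)] (C : CSG G) (H : Type) [Group H]
    (I : ∀ {k n : ℕ}, CH G k n → CH G n k)
    (hI_comp : ∀ {k m n : ℕ} (f : CH G m n) (u : CH G k m),
      I (ccomp C f u) = ccomp C (I u) (I f))
    {k n : ℕ} (f : CH2 G H k n) :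
    Ibar C H I f = ((I (f.1, f.2.1)).1, ((I (f.1, f.2.1)).2, f.2.2⁻¹)) := by
  have h := hI_comp (f.1, (1 : G k)) ((𝟙 (mk k) : mk k ⟶ mk k), f.2.1)
  rw [ccomp_factorization C (f.1, f.2.1)] at h
  rw [h]
  simp [Ibar, ccomp, ccomp2]

/-- If `I : ΔG^op → ΔG` is a duality (a functor, identity on objects, with
`I ∘ I^op = id`) and `H` is any group, then `Ī` is a well-defined functor
`(ΔG × H)^op → ΔG × H` (it preserves identities and compositions) and satisfies
`Ī ∘ Ī^op = id`. -/
theorem stmt11 (G : ℕ → Type) [∀ n, Group (G n)] (C : CSG G) (H : Type) [Group H]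
    (I : ∀ {k n : ℕ}, CH G k n → CH G n k)
    -- `I` preserves identities:
    (hI_id : ∀ n : ℕ, I ((𝟙 (mk n) : mk n ⟶ mk n), (1 : G n)) = (𝟙 (mk n), (1 : G n)))
    -- `I` is a contravariant functor:
    (hI_comp : ∀ {k m n : ℕ} (f : CH G m n) (u : CH G k m),
      I (ccomp C f u) = ccomp C (I u) (I f))
    -- `I ∘ I^op = id`:
    (hI_inv : ∀ {k n : ℕ} (f : CH G k n), I (I f) = f) :
    -- `Ī` preserves identities:
    (∀ n : ℕ, Ibar C H I ((𝟙 (mk n) : mk n ⟶ mk n), ((1 : G n), (1 : H)))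
      = (𝟙 (mk n), (1, 1))) ∧
    -- `Ī` is a contravariant functor:
    (∀ (k m n : ℕ) (f : CH2 G H m n) (u : CH2 G H k m),
      Ibar C H I (ccomp2 C H f u) = ccomp2 C H (Ibar C H I u) (Ibar C H I f)) ∧
    -- `Ī ∘ Ī^op = id`:
    (∀ (k n : ℕ) (f : CH2 G H k n), Ibar C H I (Ibar C H I f) = f) := by
  refine ⟨fun n => ?_, fun k m n f u => ?_, fun k n f => ?_⟩
  · rw [Ibar_eq C H I hI_comp]
    simp [hI_id]
  · rw [Ibar_eq C H I hI_comp, Ibar_eq C H I hI_comp, Ibar_eq C H I hI_comp]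
    have h := hI_comp (f.1, f.2.1) (u.1, u.2.1)
    simp only [ccomp] at h
    simp [ccomp2, h]
  · rw [Ibar_eq C H I hI_comp, Ibar_eq C H I hI_comp]
    simp [hI_inv]
end

section
/- Let (G,φ) be a group with parity. The category of Assoc^φ-algebras in the category of sets is isomorphic to the category of monoids with twisted G-action. In particular, if R is a set with an Assoc^φ-algebra structure {θ_k}, then R is a monoid with unit θ_0 and multiplication (a,b) ↦ θ_2((1<2),(e,e),(a,b)); for each g ∈ G the map θ_1(g,−): R → R is a monoid homomorphism if g is even and a monoid anti-homomorphism if g is odd; and θ_1(g, θ_1(h, a)) = θ_1(gh, a) for all g,h ∈ G and a ∈ R; and conversely every monoid with twisted G-action arises uniquely in this way. -/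
/-!
STATEMENT 16: for a group with parity `(G,φ)`, the category of `Assoc^φ`-algebras in
sets is isomorphic to the category of monoids with twisted `G`-action.  An operation of
`Assoc^φ(k)` is a pair of a linear ordering of `{1,…,k}` (encoded as a permutation
`ω ∈ Perm (Fin k)`, position ↦ element) and a tuple of labels in `G`.
-/

open Finset

/-- The offset of the `i`-th consecutive block: `ofs n i = ∑_{j < i} n j`. -/
def ofs {k : ℕ} (n : Fin k → ℕ) (i : Fin k) : ℕ :=
  ∑ j ∈ Finset.univ.filter (fun j => j < i), n j

theorem ofs_add_lt {k : ℕ} (n : Fin k → ℕ) (i : Fin k) (q : Fin (n i)) :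
    ofs n i + (q : ℕ) < ∑ j, n j := by
  have h1 : ofs n i + ∑ j ∈ Finset.univ.filter (fun j => ¬ j < i), n j = ∑ j, n j := by
    simpa [ofs] using Finset.sum_filter_add_sum_filter_not Finset.univ (fun j => j < i) n
  have h2 : n i ≤ ∑ j ∈ Finset.univ.filter (fun j => ¬ j < i), n j :=
    Finset.single_le_sum (f := n) (fun _ _ => Nat.zero_le _) (by simp)
  have h3 := q.isLt
  omega

/-- `IsOpComp n ω ws Θ` characterizes the operadic composite ordering
`γ(ω; ω_1,…,ω_k)` of the associative operad (see STATEMENT 15). -/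
def IsOpComp {k : ℕ} (n : Fin k → ℕ) (ω : Equiv.Perm (Fin k))
    (ws : ∀ i, Equiv.Perm (Fin (n i))) (Θ : Equiv.Perm (Fin (∑ i, n i))) : Prop :=
  ∀ (b : Fin k) (q : Fin (n (ω b)))
    (h1 : ofs (fun j => n (ω j)) b + (q : ℕ) < ∑ i, n i)
    (h2 : ofs n (ω b) + ((ws (ω b)) q : ℕ) < ∑ i, n i),
    Θ ⟨ofs (fun j => n (ω j)) b + (q : ℕ), h1⟩ = ⟨ofs n (ω b) + ((ws (ω b)) q : ℕ), h2⟩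

/-- The set of operations `Assoc^φ(k) = Assoc(k) × G^k`: a linear ordering of `{1,…,k}`
together with `k` labels in `G`. -/
abbrev AOp (G : Type) (k : ℕ) : Type := Equiv.Perm (Fin k) × (Fin k → G)

/-- An algebra over the operad `Assoc^φ = Assoc ⋊ G` in the category of sets:
structure maps `θ_k : Assoc^φ(k) × R^k → R` which are `Σ_k`-equivariant, unital and
compatible with the operadic composition.  The composition of `Assoc^φ` is
`γ((ω,g),(ω_1,h̄¹),…,(ω_k,h̄ᵏ)) = (γ_Assoc(ω; g_1ω_1,…,g_kω_k), g_1h̄¹,…,g_kh̄ᵏ)`,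
where `g_iω_i` reverses `ω_i` exactly when `g_i` is odd; it is expressed below through
the characterization `IsOpComp` of the composite ordering and the block-offset
description of the composite labels. -/
structure AlgStr (G : Type) [Group G] (φ : G →* ℤˣ) (R : Type) : Type where
  θ : ∀ k : ℕ, AOp G k → (Fin k → R) → R
  /-- `Σ_k`-equivariance, for the diagonal right `Σ_k`-action `(ω,g)·σ = (σ⁻¹∘ω, g∘σ)`. -/
  equivariance : ∀ (k : ℕ) (a : AOp G k) (σ : Equiv.Perm (Fin k)) (x : Fin k → R),
    θ k (a.1.trans σ⁻¹, a.2 ∘ σ) x = θ k a (fun i => x (σ⁻¹ i))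
  /-- unitality with respect to the unit `(1, e)` of the operad. -/
  unit : ∀ x : Fin 1 → R, θ 1 ((1 : Equiv.Perm (Fin 1)), fun _ => (1 : G)) x = x 0
  /-- compatibility with the operadic composition. -/
  comp : ∀ (k : ℕ) (a : AOp G k) (n : Fin k → ℕ) (b : ∀ i, AOp G (n i))
    (Θ : Equiv.Perm (Fin (∑ i, n i))) (lab : Fin (∑ i, n i) → G),
    IsOpComp n a.1 (fun i => if φ (a.2 i) = 1 then (b i).1 else Fin.revPerm.trans (b i).1) Θ →
    (∀ (i : Fin k) (q : Fin (n i)),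
      lab ⟨ofs n i + (q : ℕ), ofs_add_lt n i q⟩ = a.2 i * (b i).2 q) →
    ∀ x : Fin (∑ i, n i) → R,
      θ (∑ i, n i) (Θ, lab) x
        = θ k a (fun i => θ (n i) (b i) (fun q => x ⟨ofs n i + (q : ℕ), ofs_add_lt n i q⟩))

/-- The unit of the underlying twisted `G`-monoid of an `Assoc^φ`-algebra. -/
def algOne {G : Type} [Group G] {φ : G →* ℤˣ} {R : Type} (A : AlgStr G φ R) : R :=
  A.θ 0 (1, fun _ => 1) (fun i => i.elim0)

/-- The multiplication `θ_2((1<2),(e,e),(a,b))` of the underlying twisted `G`-monoid. -/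
def algMul {G : Type} [Group G] {φ : G →* ℤˣ} {R : Type} (A : AlgStr G φ R) (a b : R) : R :=
  A.θ 2 ((1 : Equiv.Perm (Fin 2)), fun _ => (1 : G)) ![a, b]

/-- The action `θ_1(g,-)` of `g ∈ G` on the underlying twisted `G`-monoid. -/
def algAct {G : Type} [Group G] {φ : G →* ℤˣ} {R : Type} (A : AlgStr G φ R) (g : G)
    (a : R) : R :=
  A.θ 1 ((1 : Equiv.Perm (Fin 1)), fun _ => g) (fun _ => a)

theorem ofs_castSucc {k : ℕ} (n : Fin (k + 1) → ℕ) (i : Fin k) :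
    ofs n i.castSucc = ofs (fun j => n j.castSucc) i := by
  simp [ofs, Finset.sum_filter, Fin.sum_univ_castSucc, (Fin.castSucc_lt_last i).not_gt]

theorem ofs_last {k : ℕ} (n : Fin (k + 1) → ℕ) :
    ofs n (Fin.last k) = ∑ j : Fin k, n j.castSucc := by
  simp [ofs, Finset.sum_filter, Fin.sum_univ_castSucc, Fin.castSucc_lt_last]

/-- An ordered product over `Fin m` is computed along consecutive blocks. -/
theorem prod_ofFn_eq_prod_blocks {M : Type} [Monoid M] {k m : ℕ} (n : Fin k → ℕ)
    (hm : ∑ i, n i = m) (F : Fin m → M) (H : ∀ i, Fin (n i) → M)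
    (hF : ∀ (i : Fin k) (q : Fin (n i)) (p : Fin m), (p : ℕ) = ofs n i + q → F p = H i q) :
    (List.ofFn F).prod = (List.ofFn fun i => (List.ofFn (H i)).prod).prod := by
  induction k generalizing m with
  | zero =>
    obtain rfl : m = 0 := by simpa using hm.symm
    simp
  | succ k ih =>
    rw [Fin.sum_univ_castSucc] at hm
    subst hm
    rw [List.ofFn_add, List.prod_append, List.ofFn_succ', List.concat_eq_append,
      List.prod_append, List.prod_singleton]
    congr 1
    · refine ih (fun i => n i.castSucc) rfl _ (fun i => H i.castSucc) fun i q p hp => ?_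
      exact hF i.castSucc q _ (by simpa [ofs_castSucc] using hp)
    · congr 2
      funext q
      exact hF (Fin.last k) q _ (by simp [ofs_last])

section Twisted

variable {G : Type} [Group G] {φ : G →* ℤˣ}

theorem map_prod_ofFn_of_map_mul {M : Type} [Monoid M] {f : M → M} (h1 : f 1 = 1)
    (hmul : ∀ a b, f (a * b) = f a * f b) {m : ℕ} (u : Fin m → M) :
    f (List.ofFn u).prod = (List.ofFn fun i => f (u i)).prod := by
  induction m with
  | zero => simpa using h1
  | succ m ih => simp [List.ofFn_succ, hmul, ih]

theorem map_prod_ofFn_of_map_mul_rev {M : Type} [Monoid M] {f : M → M} (h1 : f 1 = 1)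
    (hmul : ∀ a b, f (a * b) = f b * f a) {m : ℕ} (u : Fin m → M) :
    f (List.ofFn u).prod = (List.ofFn fun i => f (u i.rev)).prod := by
  induction m with
  | zero => simpa using h1
  | succ m ih =>
    rw [List.ofFn_succ, List.prod_cons, hmul, ih, List.ofFn_succ', List.concat_eq_append,
      List.prod_append, List.prod_singleton]
    simp [Fin.rev_castSucc]

/-- The `Assoc^φ`-algebra of a monoid with twisted `G`-action. -/
def AlgStr.ofTwisted {M : Type} [Monoid M] (act : G → M → M)
    (act_one : ∀ m, act 1 m = m)
    (act_act : ∀ g h m, act g (act h m) = act (g * h) m)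
    (act_mul_even : ∀ g, φ g = 1 → ∀ a b, act g (a * b) = act g a * act g b)
    (act_mul_odd : ∀ g, φ g = -1 → ∀ a b, act g (a * b) = act g b * act g a)
    (act_unit : ∀ g, act g (1 : M) = 1) : AlgStr G φ M where
  θ _ a x := (List.ofFn fun p => act (a.2 (a.1 p)) (x (a.1 p))).prod
  equivariance k a σ x := by simp
  unit x := by simp [act_one]
  comp k a n b Θ lab hΘ hlab x := by
    have hn : ∑ i, n (a.1 i) = ∑ i, n i := Equiv.sum_comp a.1 n
    rw [prod_ofFn_eq_prod_blocks (fun i => n (a.1 i)) hn _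
      (fun i q => act (a.2 (a.1 i)) (act ((b (a.1 i)).2
        ((if φ (a.2 (a.1 i)) = 1 then (b (a.1 i)).1 else Fin.revPerm.trans (b (a.1 i)).1) q))
        (x ⟨_, ofs_add_lt n (a.1 i) ((if φ (a.2 (a.1 i)) = 1 then (b (a.1 i)).1
          else Fin.revPerm.trans (b (a.1 i)).1) q)⟩)))]
    · congr 2
      funext i
      rcases Int.units_eq_one_or (φ (a.2 (a.1 i))) with h | h
      · rw [map_prod_ofFn_of_map_mul (act_unit _) (act_mul_even _ h)]
        simp [h]
      · rw [map_prod_ofFn_of_map_mul_rev (act_unit _) (act_mul_odd _ h)]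
        simp [h]
    · intro i q p hp
      obtain ⟨p, hlt⟩ := p
      obtain rfl : p = _ := hp
      rw [hΘ i q hlt (ofs_add_lt n _ _), act_act]
      exact congrArg (fun u => act u _) (hlab _ _)

variable {R : Type} (A : AlgStr G φ R)

/-- Compatibility with composition, with the total arity given up to equality. -/
theorem AlgStr.comp_of_sum_eq {k m : ℕ} (a : AOp G k) (n : Fin k → ℕ) (hm : ∑ i, n i = m)
    (b : ∀ i, AOp G (n i)) (y : ∀ i, Fin (n i) → R) (Θ : Equiv.Perm (Fin m)) (lab : Fin m → G)
    (x : Fin m → R)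
    (hΘ : ∀ (i : Fin k) (q : Fin (n (a.1 i))) (p : Fin m),
      (p : ℕ) = ofs (fun j => n (a.1 j)) i + q → (Θ p : ℕ) = ofs n (a.1 i) +
        ((if φ (a.2 (a.1 i)) = 1 then (b (a.1 i)).1 else Fin.revPerm.trans (b (a.1 i)).1) q : ℕ))
    (hlab : ∀ (i : Fin k) (q : Fin (n i)) (p : Fin m),
      (p : ℕ) = ofs n i + q → lab p = a.2 i * (b i).2 q)
    (hx : ∀ (i : Fin k) (q : Fin (n i)) (p : Fin m), (p : ℕ) = ofs n i + q → x p = y i q) :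
    A.θ m (Θ, lab) x = A.θ k a fun i => A.θ (n i) (b i) (y i) := by
  subst hm
  rw [A.comp k a n b Θ lab (fun i q h1 h2 => Fin.ext (hΘ i q _ rfl))
    (fun i q => hlab i q _ rfl)]
  congr 1
  funext i
  congr 1
  funext q
  exact hx i q _ rfl

/-- Every operation is an identity-ordered operation on permuted inputs. -/
theorem AlgStr.θ_eq_θ_one {k : ℕ} (ω : Equiv.Perm (Fin k)) (g : Fin k → G) (x : Fin k → R) :
    A.θ k (ω, g) x = A.θ k (1, g ∘ ω) (x ∘ ω) := by
  have h := A.equivariance k (ω, g) ω (x ∘ ω)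
  have hω : ω.trans ω⁻¹ = 1 := by ext; simp
  simp only [hω] at h
  rw [h]
  simp

theorem AlgStr.θ_zero (a : AOp G 0) (x : Fin 0 → R) : A.θ 0 a x = algOne A := by
  unfold algOne
  congr 1 <;> exact Subsingleton.elim _ _

/-- An identity-ordered operation factors through the multiplication at every cut point. -/
theorem AlgStr.θ_split {p q m : ℕ} (hm : p + q = m) (g : Fin m → G) (x : Fin m → R) :
    A.θ m (1, g) x = algMul A
      (A.θ p (1, fun i => g ((i.castAdd q).cast hm)) fun i => x ((i.castAdd q).cast hm))
      (A.θ q (1, fun i => g ((i.natAdd p).cast hm)) fun i => x ((i.natAdd p).cast hm)) := by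
  have h0 : ofs ![p, q] 0 = 0 := by simp [ofs]
  have h1 : ofs ![p, q] 1 = p := by simp [ofs, Finset.sum_filter]
  rw [A.comp_of_sum_eq (1, fun _ => 1) ![p, q] (by simpa using hm)
    (Fin.cons (1, fun i => g ((i.castAdd q).cast hm))
      (Fin.cons (1, fun i => g ((i.natAdd p).cast hm)) finZeroElim))
    (Fin.cons (fun i => x ((i.castAdd q).cast hm))
      (Fin.cons (fun i => x ((i.natAdd p).cast hm)) finZeroElim)) 1 g x]
  · unfold algMul
    congr 1
    funext i
    fin_cases i <;> rfl
  · refine Fin.forall_fin_two.2 ⟨fun i t ht => ?_, fun i t ht => ?_⟩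
    · rw [if_pos (map_one φ)]
      exact ht
    · rw [if_pos (map_one φ)]
      exact ht
  · refine Fin.forall_fin_two.2 ⟨fun i t ht => ?_, fun i t ht => ?_⟩
    · rw [one_mul]
      exact congrArg g (Fin.ext (ht.trans (by rw [h0, zero_add]; rfl)))
    · rw [one_mul]
      exact congrArg g (Fin.ext (ht.trans (by rw [h1]; rfl)))
  · refine Fin.forall_fin_two.2 ⟨fun i t ht => ?_, fun i t ht => ?_⟩
    · exact congrArg x (Fin.ext (ht.trans (by rw [h0, zero_add]; rfl)))
    · exact congrArg x (Fin.ext (ht.trans (by rw [h1]; rfl)))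

theorem AlgStr.θ_one (g : Fin 1 → G) (x : Fin 1 → R) : A.θ 1 (1, g) x = algAct A (g 0) (x 0) := by
  unfold algAct
  congr 2 <;> funext i <;> rw [Subsingleton.elim i 0]

theorem algAct_one (a : R) : algAct A 1 a = a := A.unit _

theorem AlgStr.θ_succ {k : ℕ} (g : Fin (k + 1) → G) (x : Fin (k + 1) → R) :
    A.θ (k + 1) (1, g) x
      = algMul A (algAct A (g 0) (x 0)) (A.θ k (1, fun i => g i.succ) fun i => x i.succ) := by
  have h : ∀ i : Fin k, (i.natAdd 1).cast (Nat.add_comm 1 k) = i.succ := fun i =>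
    Fin.ext (Nat.add_comm _ _)
  rw [A.θ_split (Nat.add_comm 1 k), A.θ_one]
  simp only [h]
  rfl

theorem algMul_algOne (a : R) : algMul A a (algOne A) = a := by
  have h := A.θ_succ (fun _ => 1) (fun _ : Fin 1 => a)
  rw [A.θ_zero, A.θ_one, algAct_one] at h
  exact h.symm

theorem algOne_algMul (a : R) : algMul A (algOne A) a = a := by
  have h := A.θ_split (zero_add 1) (fun _ => 1) (fun _ : Fin 1 => a)
  rw [A.θ_zero] at h
  simp only [A.θ_one, algAct_one] at h
  exact h.symm

theorem AlgStr.θ_two (g : Fin 2 → G) (x : Fin 2 → R) :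
    A.θ 2 (1, g) x = algMul A (algAct A (g 0) (x 0)) (algAct A (g 1) (x 1)) := by
  rw [A.θ_succ, A.θ_one]
  rfl

theorem algMul_assoc (a b c : R) :
    algMul A (algMul A a b) c = algMul A a (algMul A b c) := by
  have h := A.θ_succ (fun _ => 1) ![a, b, c]
  rw [A.θ_split (show 2 + 1 = 3 from rfl), A.θ_two, A.θ_one, A.θ_two] at h
  simp only [algAct_one] at h
  exact h

theorem algAct_θ (g : G) {m : ℕ} (ω : Equiv.Perm (Fin m)) (h : Fin m → G) (x : Fin m → R) :
    algAct A g (A.θ m (ω, h) x)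
      = A.θ m (if φ g = 1 then ω else Fin.revPerm.trans ω, fun i => g * h i) x := by
  have h0 : ∀ i : Fin 1, ofs (fun _ => m) i = 0 := by simp [ofs]
  refine (A.comp_of_sum_eq (1, fun _ => g) (fun _ => m) (by simp) (fun _ => (ω, h)) (fun _ => x)
    _ _ _ ?_ ?_ ?_).symm
  · intro i q p hp
    obtain rfl : p = q := Fin.ext (by simpa [h0] using hp)
    simp [h0]
  · intro i q p hp
    obtain rfl : p = q := Fin.ext (by simpa [h0] using hp)
    rfl
  · intro i q p hp
    obtain rfl : p = q := Fin.ext (by simpa [h0] using hp)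
    rfl

theorem algAct_algOne (g : G) : algAct A g (algOne A) = algOne A := by
  rw [algOne, algAct_θ, A.θ_zero]
  rfl

theorem algAct_algAct (g h : G) (a : R) : algAct A g (algAct A h a) = algAct A (g * h) a := by
  rw [algAct, algAct, ← algAct, algAct_θ, Subsingleton.elim (ite _ _ _) 1, A.θ_one]

theorem algAct_algMul_of_even {g : G} (hg : φ g = 1) (a b : R) :
    algAct A g (algMul A a b) = algMul A (algAct A g a) (algAct A g b) := by
  rw [algMul, algAct_θ, if_pos hg, A.θ_two]
  simp

theorem algAct_algMul_of_odd {g : G} (hg : φ g = -1) (a b : R) :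
    algAct A g (algMul A a b) = algMul A (algAct A g b) (algAct A g a) := by
  rw [algMul, algAct_θ, if_neg (by rw [hg]; decide), A.θ_eq_θ_one, A.θ_two]
  simp

theorem map_θ_of_map_algMul {S : Type} (B : AlgStr G φ S) (f : R → S)
    (hone : f (algOne A) = algOne B) (hmul : ∀ a b, f (algMul A a b) = algMul B (f a) (f b))
    (hact : ∀ g a, f (algAct A g a) = algAct B g (f a)) (k : ℕ) (a : AOp G k) (x : Fin k → R) :
    f (A.θ k a x) = B.θ k a fun i => f (x i) := by
  have key : ∀ (g : Fin k → G) (x : Fin k → R),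
      f (A.θ k (1, g) x) = B.θ k (1, g) fun i => f (x i) := by
    clear a x
    induction k with
    | zero => intro g x; rw [A.θ_zero, B.θ_zero, hone]
    | succ k ih => intro g x; rw [A.θ_succ, B.θ_succ, hmul, hact, ih]
  obtain ⟨ω, g⟩ := a
  rw [A.θ_eq_θ_one, B.θ_eq_θ_one, key]
  rfl

theorem AlgStr.eq_of_algMul_eq {A B : AlgStr G φ R} (hone : algOne A = algOne B)
    (hmul : ∀ a b, algMul A a b = algMul B a b) (hact : ∀ g a, algAct A g a = algAct B g a) :
    A = B := by
  have h : A.θ = B.θ := by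
    funext k a x
    exact map_θ_of_map_algMul A B id hone hmul hact k a x
  cases A
  cases B
  cases h
  rfl

end Twisted

/-- The category of `Assoc^φ`-algebras in sets is isomorphic to the category of monoids
with twisted `G`-action: (A) every `Assoc^φ`-algebra `R` is a monoid with unit `θ_0`,
multiplication `θ_2((1<2),(e,e),-)`, on which each `θ_1(g,-)` acts as a monoid
homomorphism if `g` is even and a monoid anti-homomorphism if `g` is odd, with
`θ_1(g,θ_1(h,-)) = θ_1(gh,-)`; (B) conversely every monoid with twisted `G`-action
arises in this way from a unique `Assoc^φ`-algebra structure; and (C) a map of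
`Assoc^φ`-algebras is exactly a `G`-equivariant monoid homomorphism, so the
correspondence is an isomorphism of categories. -/
theorem stmt16 (G : Type) [Group G] (φ : G →* ℤˣ) :
    -- (A) the underlying twisted `G`-monoid of an algebra:
    (∀ (R : Type) (A : AlgStr G φ R),
      (∀ a b c : R, algMul A (algMul A a b) c = algMul A a (algMul A b c)) ∧
      (∀ a : R, algMul A (algOne A) a = a) ∧
      (∀ a : R, algMul A a (algOne A) = a) ∧
      (∀ (g : G) (a b : R), φ g = 1 →
        algAct A g (algMul A a b) = algMul A (algAct A g a) (algAct A g b)) ∧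
      (∀ (g : G) (a b : R), φ g = -1 →
        algAct A g (algMul A a b) = algMul A (algAct A g b) (algAct A g a)) ∧
      (∀ g : G, algAct A g (algOne A) = algOne A) ∧
      (∀ (g h : G) (a : R), algAct A g (algAct A h a) = algAct A (g * h) a) ∧
      (∀ a : R, algAct A 1 a = a)) ∧
    -- (B) every monoid with twisted `G`-action arises from a unique algebra structure:
    (∀ (M : Type) (_ : Monoid M) (act : G → M → M),
      (∀ m, act 1 m = m) →
      (∀ g h m, act g (act h m) = act (g * h) m) →
      (∀ g, φ g = 1 → ∀ a b, act g (a * b) = act g a * act g b) →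
      (∀ g, φ g = -1 → ∀ a b, act g (a * b) = act g b * act g a) →
      (∀ g, act g (1 : M) = 1) →
      ∃! A : AlgStr G φ M,
        algOne A = 1 ∧ (∀ a b : M, algMul A a b = a * b) ∧ ∀ g a, algAct A g a = act g a) ∧
    -- (C) morphisms of algebras are exactly `G`-equivariant monoid homomorphisms:
    (∀ (R S : Type) (A : AlgStr G φ R) (B : AlgStr G φ S) (f : R → S),
      (∀ (k : ℕ) (a : AOp G k) (x : Fin k → R), f (A.θ k a x) = B.θ k a (fun i => f (x i))) ↔
      (f (algOne A) = algOne B ∧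
       (∀ a b : R, f (algMul A a b) = algMul B (f a) (f b)) ∧
       (∀ (g : G) (a : R), f (algAct A g a) = algAct B g (f a)))) := by
  refine ⟨fun R A => ⟨algMul_assoc A, algOne_algMul A, algMul_algOne A,
    fun g a b hg => algAct_algMul_of_even A hg a b, fun g a b hg => algAct_algMul_of_odd A hg a b,
    algAct_algOne A, algAct_algAct A, algAct_one A⟩, ?_, ?_⟩
  · intro M _ act act_one act_act act_even act_odd act_unit
    refine ⟨AlgStr.ofTwisted act act_one act_act act_even act_odd act_unit, ⟨?_, ?_, ?_⟩, ?_⟩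
    · simp [algOne, AlgStr.ofTwisted]
    · intro a b
      simp [algMul, AlgStr.ofTwisted, act_one]
    · intro g a
      simp [algAct, AlgStr.ofTwisted]
    · rintro A ⟨hone, hmul, hact⟩
      refine AlgStr.eq_of_algMul_eq ?_ ?_ ?_
      · rw [hone]
        simp [algOne, AlgStr.ofTwisted]
      · intro a b
        rw [hmul]
        simp [algMul, AlgStr.ofTwisted, act_one]
      · intro g a
        rw [hact]
        simp [algAct, AlgStr.ofTwisted]
  · refine fun R S A B f => ⟨fun h => ⟨?_, ?_, ?_⟩, fun h => ?_⟩
    · rw [algOne, h, B.θ_zero]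
    · intro a b
      rw [algMul, h, B.θ_two]
      simp [algAct_one]
    · intro g a
      exact h 1 _ _
    · exact map_θ_of_map_algMul A B f h.1 h.2.1 h.2.2
end

section
/- Let {G_n}_{n≥0} be a crossed simplicial group. For every g ∈ G₀, the element (σ₀*(g))*(δ₀) ∈ Δ([0],[1]) equals δ₀ or δ₁, so the canonical parity λ₀: G₀ → C₂, defined by λ₀(g) = 1 if (σ₀*(g))*(δ₀) = δ₀ and λ₀(g) = −1 if (σ₀*(g))*(δ₀) = δ₁, is a well-defined map, and λ₀ is a group homomorphism. -/
/-!
STATEMENT 17: the canonical parity `λ₀ : G₀ → C₂` of a crossed simplicial group is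
well defined and is a group homomorphism.
-/

open CategoryTheory SimplexCategory

/-- The morphisms `[0] ⟶ [1]` are exactly the two faces. -/
theorem eq_delta_zero_or_eq_delta_one (f : mk 0 ⟶ mk 1) :
    f = SimplexCategory.δ (0 : Fin 2) ∨ f = SimplexCategory.δ (1 : Fin 2) := by
  have key : ∀ f' : mk 0 ⟶ mk 1, f.toOrderHom 0 = f'.toOrderHom 0 → f = f' := by
    intro f' h
    refine SimplexCategory.Hom.ext _ _ (OrderHom.ext _ _ (funext fun (x : Fin 1) => ?_))
    rw [Subsingleton.elim x 0]
    exact h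
  have h0 : (SimplexCategory.δ (0 : Fin 2) : mk 0 ⟶ mk 1).toOrderHom 0 = (1 : Fin 2) := rfl
  have h1 : (SimplexCategory.δ (1 : Fin 2) : mk 0 ⟶ mk 1).toOrderHom 0 = (0 : Fin 2) := rfl
  have h2 : ∀ x : Fin 2, x = 1 ∨ x = 0 := by decide
  rcases h2 (f.toOrderHom 0) with h | h
  · exact Or.inl (key _ (h.trans h0.symm))
  · exact Or.inr (key _ (h.trans h1.symm))

namespace CSG

variable {G : ℕ → Type} [∀ n, Group (G n)] (C : CSG G)

theorem vact_injective {m n : ℕ} (g : G n) :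
    Function.Injective (C.vact (m := m) g) := by
  refine Function.LeftInverse.injective (g := C.vact g⁻¹) fun ψ => ?_
  rw [← C.id1v, mul_inv_cancel, C.id3v₁]

/-- Pulling back along a map to the terminal object `[0]` is multiplicative. -/
theorem hact_mul_of_zero {m : ℕ} (ψ : SimplexCategory.mk m ⟶ SimplexCategory.mk 0)
    (g h : G 0) :
    C.hact ψ (g * h) = C.hact ψ g * C.hact ψ h := by
  rw [C.id2v, Subsingleton.elim (C.vact g ψ) ψ]

end CSG

theorem stmt17 (G : ℕ → Type) [∀ n, Group (G n)] (C : CSG G) :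
    -- `(σ₀*(g))*(δ₀)` equals `δ₀` or `δ₁`, so the canonical parity is well defined:
    (∀ g : G 0,
      C.vact (C.hact (SimplexCategory.σ (0 : Fin 1)) g) (SimplexCategory.δ (0 : Fin 2))
          = SimplexCategory.δ (0 : Fin 2) ∨
      C.vact (C.hact (SimplexCategory.σ (0 : Fin 1)) g) (SimplexCategory.δ (0 : Fin 2))
          = SimplexCategory.δ (1 : Fin 2)) ∧
    -- and any function `λ₀ : G₀ → C₂` satisfying the defining property of the canonical
    -- parity is a group homomorphism:
    (∀ lam : G 0 → ℤˣ,
      (∀ g : G 0,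
        (C.vact (C.hact (SimplexCategory.σ (0 : Fin 1)) g) (SimplexCategory.δ (0 : Fin 2))
            = SimplexCategory.δ (0 : Fin 2) → lam g = 1) ∧
        (C.vact (C.hact (SimplexCategory.σ (0 : Fin 1)) g) (SimplexCategory.δ (0 : Fin 2))
            = SimplexCategory.δ (1 : Fin 2) → lam g = -1)) →
      ∀ g h : G 0, lam (g * h) = lam g * lam h) := by
  refine ⟨fun g => eq_delta_zero_or_eq_delta_one _, fun lam hlam g h => ?_⟩
  have hgh := C.hact_mul_of_zero (SimplexCategory.σ (0 : Fin 1)) g h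
  have hne : (SimplexCategory.δ (0 : Fin 2) : mk 0 ⟶ mk 1) ≠ SimplexCategory.δ (1 : Fin 2) :=
    fun e => by simpa using SimplexCategory.δ_injective e
  have hlamgh := hlam (g * h)
  rw [hgh, C.id1v] at hlamgh
  rcases eq_delta_zero_or_eq_delta_one
    (C.vact (C.hact (SimplexCategory.σ (0 : Fin 1)) g) (SimplexCategory.δ (0 : Fin 2)))
    with hg | hg <;>
  rcases eq_delta_zero_or_eq_delta_one
    (C.vact (C.hact (SimplexCategory.σ (0 : Fin 1)) h) (SimplexCategory.δ (0 : Fin 2)))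
    with hh | hh <;>
  rw [hg] at hlamgh
  · rw [hlamgh.1 hh, (hlam g).1 hg, (hlam h).1 hh, mul_one]
  · rw [hlamgh.2 hh, (hlam g).1 hg, (hlam h).2 hh, one_mul]
  · have h1 := (eq_delta_zero_or_eq_delta_one (C.vact (C.hact (SimplexCategory.σ (0 : Fin 1)) h)
      (SimplexCategory.δ (1 : Fin 2)))).resolve_left
        fun e => hne (C.vact_injective _ (hh.trans e.symm))
    rw [hlamgh.2 h1, (hlam g).2 hg, (hlam h).1 hh, mul_one]
  · have h1 := (eq_delta_zero_or_eq_delta_one (C.vact (C.hact (SimplexCategory.σ (0 : Fin 1)) h)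
      (SimplexCategory.δ (1 : Fin 2)))).resolve_right
        fun e => hne (C.vact_injective _ (hh.trans e.symm))
    rw [hlamgh.1 h1, (hlam g).2 hg, (hlam h).2 hh, neg_mul_neg, one_mul]
end
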